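/- Let G be a finite group and let X be a G-module that is free as a ℤ-module. The following are equivalent: (a) X is an r-encoding module; (b) Ĥ^r(G, X) ≅ ℤ/|G|ℤ and Ĥ^0(G, Hom_ℤ(X, X)) ≅ ℤ/|G|ℤ; (c) Ĥ^r(G, X) ≅ ℤ/|G|ℤ and Ĥ^0(G, Hom_ℤ(X, X)) is a cyclic group. -/

import Mathlib

/-!
This file sets up Tate cohomology of a finite group `G` (with coefficients in objects of
`Rep ℤ G`), realized concretely in each degree `n ∈ ℤ` as
`Ĥ^n(G, M) = Ĥ⁰(G, Hom_ℤ(J n, M))`, where `J n` is the standard `n`-th syzygy of the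
trivial module `ℤ` (the `n`-th tensor power of the augmentation ideal `I_G` for `n ≥ 0`,
and of its `ℤ`-linear dual for `n < 0`), and `Ĥ⁰` denotes invariants modulo norms.
Cup products are induced by the canonical comparison maps `J (i+j) ⟶ J i ⊗ J j`.
-/

open CategoryTheory MonoidalCategory TensorProduct

set_option linter.unusedSectionVars false
set_option maxHeartbeats 1000000

attribute [instance 0] AddCommGroup.toIntModule

namespace Enc

variable {k : Type} [CommRing k] {G : Type} [Group G] [Fintype G]

/-! ### Degree-zero Tate cohomology: invariants modulo norms -/

section Aux
variable {V V₂ : Type} [AddCommGroup V] [Module k V] [AddCommGroup V₂] [Module k V₂]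

/-- The norm map `v ↦ ∑_{g ∈ G} g • v` of a representation. -/
noncomputable def rnorm (ρ : Representation k G V) : V →ₗ[k] V := ∑ g : G, ρ g

lemma rnorm_mem_invariants (ρ : Representation k G V) (v : V) :
    rnorm ρ v ∈ ρ.invariants := by
  intro g
  show (ρ g) ((∑ h : G, ρ h) v) = _
  simp only [LinearMap.sum_apply, map_sum]
  rw [Fintype.sum_equiv (Equiv.mulLeft g) _ (fun h => ρ h v) (fun h => by
    rw [← Module.End.mul_apply, ← map_mul]; rfl)]
  simp [rnorm]

/-- The norm map, viewed as landing in the invariants. -/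
noncomputable def rnormRes (ρ : Representation k G V) : V →ₗ[k] ρ.invariants :=
  (rnorm ρ).codRestrict ρ.invariants (rnorm_mem_invariants ρ)

/-- The image of the norm map, inside the invariants. -/
noncomputable def rnormIm (ρ : Representation k G V) : Submodule k ρ.invariants :=
  LinearMap.range (rnormRes ρ)

/-- Degree-zero Tate cohomology of a representation: invariants modulo norms. -/
noncomputable def tate0 (ρ : Representation k G V) : Type :=
  ρ.invariants ⧸ rnormIm ρ

noncomputable instance (ρ : Representation k G V) : AddCommGroup (tate0 ρ) :=
  inferInstanceAs (AddCommGroup (ρ.invariants ⧸ rnormIm ρ))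

noncomputable instance (ρ : Representation k G V) : Module k (tate0 ρ) :=
  inferInstanceAs (Module k (ρ.invariants ⧸ rnormIm ρ))

/-- The Tate class of an invariant vector. -/
noncomputable def tate0mk {ρ : Representation k G V} (v : V) (hv : v ∈ ρ.invariants) :
    tate0 ρ := Submodule.Quotient.mk (⟨v, hv⟩ : ρ.invariants)

lemma invariants_comp {ρ : Representation k G V} {σ : Representation k G V₂}
    (f : V →ₗ[k] V₂) (hf : ∀ (g : G) (v : V), f (ρ g v) = σ g (f v)) :
    ∀ x ∈ ρ.invariants, f x ∈ σ.invariants := by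
  intro x hx g
  rw [← hf g x, hx g]

/-- Functoriality of degree-zero Tate cohomology along equivariant maps. -/
noncomputable def tate0map {ρ : Representation k G V} {σ : Representation k G V₂}
    (f : V →ₗ[k] V₂) (hf : ∀ (g : G) (v : V), f (ρ g v) = σ g (f v)) :
    tate0 ρ →ₗ[k] tate0 σ :=
  Submodule.mapQ (rnormIm ρ) (rnormIm σ) (f.restrict (invariants_comp f hf))
    (by
      rintro ⟨x, hx⟩ ⟨y, hy⟩
      refine ⟨f y, ?_⟩
      apply Subtype.ext
      have hy' := congrArg Subtype.val hy
      show rnorm σ (f y) = _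
      simp only [LinearMap.restrict_apply]
      have : rnorm σ (f y) = f (rnorm ρ y) := by
        simp only [rnorm, LinearMap.sum_apply, map_sum]
        exact Finset.sum_congr rfl fun g _ => (hf g y).symm
      rw [this]
      exact congrArg f hy')

end Aux

/-- Degree-zero Tate cohomology `Ĥ⁰(G, W) = W^G / N_G W` of an object of `Rep k G`. -/
noncomputable def H0T (W : Rep k G) : Type := tate0 W.ρ

noncomputable instance (W : Rep k G) : AddCommGroup (H0T W) :=
  inferInstanceAs (AddCommGroup (tate0 W.ρ))

noncomputable instance (W : Rep k G) : Module k (H0T W) :=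
  inferInstanceAs (Module k (tate0 W.ρ))

/-- Functoriality of `Ĥ⁰` along morphisms of representations. -/
noncomputable def H0Tmap {W W' : Rep k G} (ψ : W ⟶ W') : H0T W →ₗ[k] H0T W' :=
  tate0map ψ.hom (fun g v => Rep.hom_comm_apply ψ g v)

/-! ### The augmentation ideal and the syzygy modules `J n` -/

variable (G)

/-- The augmentation map `ℤ[G] → ℤ`. -/
noncomputable def aug : (G →₀ ℤ) →ₗ[ℤ] ℤ :=
  Finsupp.linearCombination ℤ (fun _ : G => (1 : ℤ))

lemma aug_comm (g : G) (x : G →₀ ℤ) :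
    aug G (Finsupp.lmapDomain ℤ ℤ (g • ·) x) = aug G x := by
  unfold aug
  simp [Finsupp.lmapDomain_apply, Finsupp.linearCombination_apply]
  rw [Finsupp.sum_mapDomain_index] <;> simp

/-- The underlying `ℤ`-module of the augmentation ideal. -/
noncomputable abbrev IGcar : Type := LinearMap.ker (aug G)

/-- The representation of `G` on the augmentation ideal. -/
noncomputable def IGρ : Representation ℤ G (IGcar G) where
  toFun g := (Finsupp.lmapDomain ℤ ℤ (g • ·) : (G →₀ ℤ) →ₗ[ℤ] (G →₀ ℤ)).restrict (p := LinearMap.ker (aug G))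
    (q := LinearMap.ker (aug G)) (by
      intro x hx
      simp only [LinearMap.mem_ker] at hx ⊢
      rw [aug_comm]; exact hx)
  map_one' := by
    ext x; simp [LinearMap.restrict_apply]; exact DFunLike.congr_fun Finsupp.mapDomain_id _
  map_mul' g h := by
    ext x; simp [LinearMap.restrict_apply, Module.End.mul_apply, mul_assoc]
    exact DFunLike.congr_fun Finsupp.mapDomain_comp _

/-- The augmentation ideal `I_G` of `ℤ[G]`, as an object of `Rep ℤ G`. -/
noncomputable def IGrep : Rep ℤ G := Rep.of (IGρ G)

/-- `Hom_ℤ(X, A)` with the conjugation `G`-action, i.e. the internal hom in `Rep ℤ G`. -/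
noncomputable abbrev hRep {G : Type} [Group G] (X A : Rep.{0} ℤ G) : Rep.{0} ℤ G :=
  (Rep.ihom X).obj A

/-- The `ℤ`-linear dual of the augmentation ideal, as an object of `Rep ℤ G`. -/
noncomputable def DIG : Rep ℤ G := hRep (IGrep G) (𝟙_ (Rep ℤ G))

instance : Module.Finite ℤ (IGcar G) := by
  have : Module.Finite ℤ (G →₀ ℤ) :=
    Module.Finite.equiv (Finsupp.linearEquivFunOnFinite ℤ ℤ G).symm
  exact Module.Finite.of_injective (LinearMap.ker (aug G)).subtype Subtype.val_injective

instance : Module.Free ℤ (IGcar G) := by infer_instance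

/-- Nonnegative tensor powers `I_G^{⊗ n}` (with `I_G^{⊗ 0} = ℤ`). -/
noncomputable def Jp : ℕ → Rep ℤ G
  | 0 => 𝟙_ (Rep ℤ G)
  | n + 1 => Jp n ⊗ IGrep G

/-- Tensor powers of the dual of the augmentation ideal. -/
noncomputable def Jn : ℕ → Rep ℤ G
  | 0 => 𝟙_ (Rep ℤ G)
  | n + 1 => Jn n ⊗ DIG G

/-- The standard syzygy modules of the trivial representation `ℤ`, indexed by `ℤ`:
`J n = I_G^{⊗ n}` for `n ≥ 0`, and `J n = (I_G^∨)^{⊗ (-n)}` for `n < 0`. -/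
noncomputable def J : ℤ → Rep ℤ G
  | .ofNat n => Jp G n
  | .negSucc n => Jn G (n + 1)

lemma J_ofNat (m : ℕ) : J G (m : ℤ) = Jp G m := rfl

lemma J_neg (m : ℕ) : J G (-(m : ℤ)) = Jn G m := by cases m <;> rfl

/-- The element of `(I_G)^∨ ⊗ I_G` corresponding to the identity map. -/
noncomputable def preElt : Module.Dual ℤ (IGcar G) ⊗[ℤ] IGcar G :=
  (dualTensorHomEquiv ℤ (IGcar G) (IGcar G)).symm LinearMap.id

/-- The canonical element of `I_G ⊗ (I_G)^∨` corresponding to the identity map. -/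
noncomputable def coevElt : (IGrep G ⊗ DIG G).V :=
  (TensorProduct.comm ℤ _ _) (preElt G)

lemma conj_dualTensor (g : G) (t : Module.Dual ℤ (IGcar G) ⊗[ℤ] IGcar G) :
    dualTensorHom ℤ _ _ (TensorProduct.map ((DIG G).ρ g) ((IGrep G).ρ g) t)
      = (IGrep G).ρ g ∘ₗ (dualTensorHom ℤ _ _ t) ∘ₗ (IGrep G).ρ g⁻¹ := by
  exact LinearMap.congr_fun (Representation.dualTensorHom_comm (IGρ G) (IGρ G) g) t

lemma coevElt_invariant (g : G) :
    ((IGrep G ⊗ DIG G).ρ g) (coevElt G) = coevElt G := by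
  show TensorProduct.map ((IGrep G).ρ g) ((DIG G).ρ g)
      ((TensorProduct.comm ℤ _ _) (preElt G)) = _
  refine (TensorProduct.map_comm _ _ _).trans ?_
  show (TensorProduct.comm ℤ _ _) (TensorProduct.map ((DIG G).ρ g) ((IGrep G).ρ g) (preElt G))
      = (TensorProduct.comm ℤ _ _) (preElt G)
  congr 1
  apply (dualTensorHomEquiv ℤ (IGcar G) (IGcar G)).injective
  have h2 : dualTensorHom ℤ (IGcar G) (IGcar G) (preElt G) = LinearMap.id :=
    (dualTensorHomEquiv ℤ (IGcar G) (IGcar G)).apply_symm_apply LinearMap.id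
  show dualTensorHom ℤ (IGcar G) (IGcar G)
      (TensorProduct.map ((DIG G).ρ g) ((IGrep G).ρ g) (preElt G))
    = dualTensorHom ℤ (IGcar G) (IGcar G) (preElt G)
  refine (conj_dualTensor G g (preElt G)).trans ?_
  show (IGrep G).ρ g ∘ₗ dualTensorHom ℤ (IGcar G) (IGcar G) (preElt G) ∘ₗ (IGrep G).ρ g⁻¹
      = dualTensorHom ℤ (IGcar G) (IGcar G) (preElt G)
  rw [h2]
  apply LinearMap.ext
  intro v
  exact Representation.self_inv_apply (IGrep G).ρ g v

/-- The coevaluation `ℤ ⟶ I_G ⊗ I_G^∨`. -/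
noncomputable def coev : 𝟙_ (Rep ℤ G) ⟶ IGrep G ⊗ DIG G :=
  Rep.ofHom (ρ := (𝟙_ (Rep ℤ G)).ρ) (σ := (IGrep G ⊗ DIG G).ρ) {
  toLinearMap := LinearMap.toSpanSingleton ℤ _ (coevElt G)
  isIntertwining' := by
    intro g
    apply LinearMap.ext
    intro z
    show LinearMap.toSpanSingleton ℤ _ (coevElt G) ((𝟙_ (Rep ℤ G)).ρ g z)
        = ((IGrep G ⊗ DIG G).ρ g) (LinearMap.toSpanSingleton ℤ _ (coevElt G) z)
    have hz : ((𝟙_ (Rep ℤ G)).ρ g z) = z := rfl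
    rw [hz]
    show z • coevElt G = ((IGrep G ⊗ DIG G).ρ g) (z • coevElt G)
    rw [map_smul, coevElt_invariant] }


variable {G}

/-- One-step comparison `J (n+1) ⟶ J n ⊗ I_G`. -/
noncomputable def sMap : ∀ n : ℤ, J G (n + 1) ⟶ J G n ⊗ IGrep G
  | .ofNat m => 𝟙 (Jp G m ⊗ IGrep G)
  | .negSucc 0 =>
      coev G ≫ (β_ (IGrep G) (DIG G)).hom ≫ ((λ_ (DIG G)).inv ▷ IGrep G)
  | .negSucc (m+1) =>
      (ρ_ (Jn G (m+1))).inv ≫ (Jn G (m+1) ◁ (coev G ≫ (β_ (IGrep G) (DIG G)).hom))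
        ≫ (α_ (Jn G (m+1)) (DIG G) (IGrep G)).inv

/-- One-step comparison `J (n-1) ⟶ J n ⊗ I_G^∨`. -/
noncomputable def tMap : ∀ n : ℤ, J G (n - 1) ⟶ J G n ⊗ DIG G
  | .ofNat 0 => 𝟙 (𝟙_ (Rep ℤ G) ⊗ DIG G)
  | .ofNat (m+1) =>
      eqToHom (congrArg (J G) (show (Int.ofNat (m+1)) - 1 = ((m:ℕ) : ℤ) by
        rw [Int.ofNat_eq_coe]; push_cast; ring)) ≫
      (ρ_ (Jp G m)).inv ≫ (Jp G m ◁ coev G) ≫ (α_ (Jp G m) (IGrep G) (DIG G)).inv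
  | .negSucc m => eqToHom (show J G (Int.negSucc m - 1) = J G (Int.negSucc m) ⊗ DIG G from rfl)

/-- Comparison maps `J (i + m) ⟶ J i ⊗ J m` for `m ≥ 0`. -/
noncomputable def μpos (i : ℤ) : ∀ m : ℕ, J G (i + m) ⟶ J G i ⊗ J G (m : ℤ)
  | 0 => eqToHom (congrArg (J G) (by omega)) ≫ (ρ_ (J G i)).inv
  | m + 1 =>
      eqToHom (congrArg (J G) (show i + ((m:ℕ)+1:ℕ) = (i + m) + 1 by omega))
        ≫ sMap (i + m) ≫ (μpos i m ▷ IGrep G) ≫ (α_ (J G i) (J G (m:ℤ)) (IGrep G)).hom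

/-- Comparison maps `J (i - m) ⟶ J i ⊗ J (-m)` for `m ≥ 0`. -/
noncomputable def μneg (i : ℤ) : ∀ m : ℕ, J G (i - m) ⟶ J G i ⊗ J G (-(m : ℤ))
  | 0 => eqToHom (congrArg (J G) (by omega)) ≫ (ρ_ (J G i)).inv
  | m + 1 =>
      eqToHom (congrArg (J G) (show i - ((m:ℕ)+1:ℕ) = (i - m) - 1 by omega))
        ≫ tMap (i - m) ≫ (μneg i m ▷ DIG G) ≫ (α_ (J G i) (J G (-(m:ℤ))) (DIG G)).hom
        ≫ (J G i ◁ (eqToHom (show J G (-(m:ℤ)) ⊗ DIG G = J G (-((m:ℕ)+1:ℕ)) by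
            rw [J_neg, J_neg]; rfl)))

variable (G)

/-- The canonical comparison map `J (i+j) ⟶ J i ⊗ J j`, implementing the standard stable
equivalences between the syzygies `J`; it induces the cup product on Tate cohomology. -/
noncomputable def μ (i : ℤ) : ∀ j : ℤ, J G (i + j) ⟶ J G i ⊗ J G j
  | .ofNat m => μpos i m
  | .negSucc m =>
      eqToHom (congrArg (J G) (show i + Int.negSucc m = i - ((m+1 : ℕ) : ℤ) by
        rw [Int.negSucc_eq]; push_cast; ring))
        ≫ μneg i (m+1)

variable {G}

/-! ### Tate cohomology in all degrees, functoriality, cup products -/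

/-- Tate cohomology `Ĥ^n(G, M)` of the finite group `G` with coefficients in `M : Rep ℤ G`,
realized as `Ĥ⁰(G, Hom_ℤ(J n, M))` for the standard `n`-th syzygy `J n` of `ℤ`. -/
noncomputable def tate (n : ℤ) (M : Rep ℤ G) : Type := H0T (hRep (J G n) M)

noncomputable instance (n : ℤ) (M : Rep ℤ G) : AddCommGroup (tate n M) :=
  inferInstanceAs (AddCommGroup (H0T (hRep (J G n) M)))

/-- The map on Tate cohomology induced by a morphism of representations. -/
noncomputable def tmap (n : ℤ) {M N : Rep ℤ G} (φ : M ⟶ N) : tate n M → tate n N :=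
  H0Tmap ((Rep.ihom (J G n)).map φ)

/-- Transport of Tate cohomology along an equality of degrees. -/
noncomputable def tcast {i j : ℤ} {M : Rep ℤ G} (h : i = j) (z : tate i M) : tate j M :=
  h ▸ z

lemma hom_invariant {X W : Rep.{0} ℤ G} (m : X ⟶ W) :
    m.hom.toLinearMap ∈ (hRep X W).ρ.invariants := by
  intro g
  show W.ρ g ∘ₗ m.hom.toLinearMap ∘ₗ X.ρ g⁻¹ = m.hom.toLinearMap
  ext v
  simp only [LinearMap.comp_apply]
  erw [Rep.hom_comm_apply m g⁻¹ v, Representation.self_inv_apply]; rfl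

/-- The Tate cohomology class of a `G`-equivariant map `J n ⟶ W`. -/
noncomputable def mkCls {n : ℤ} {W : Rep ℤ G} (m : J G n ⟶ W) : tate n W :=
  tate0mk (ρ := (hRep (J G n) W).ρ) m.hom.toLinearMap (hom_invariant m)


lemma tensor_rho_eq (M N : Rep ℤ G) (g : G) :
    (M ⊗ N).ρ g = TensorProduct.map (M.ρ g) (N.ρ g) := rfl

section MapAux
variable {R A B C P Q : Type} [CommRing R] [AddCommGroup A] [AddCommGroup B] [AddCommGroup C]
  [AddCommGroup P] [AddCommGroup Q] [Module R A] [Module R B] [Module R C] [Module R P] [Module R Q]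

lemma map_conj_aux (u : A →ₗ[R] P) (w : B →ₗ[R] Q) (m : C →ₗ[R] A ⊗[R] B) (p : P →ₗ[R] P)
    (q : Q →ₗ[R] Q) (a : A →ₗ[R] A) (b : B →ₗ[R] B) (c : C →ₗ[R] C)
    (hm : m ∘ₗ c = TensorProduct.map a b ∘ₗ m) :
    TensorProduct.map p q ∘ₗ (TensorProduct.map u w ∘ₗ m) ∘ₗ c
      = TensorProduct.map (p ∘ₗ u ∘ₗ a) (q ∘ₗ w ∘ₗ b) ∘ₗ m := by
  rw [LinearMap.comp_assoc, hm, TensorProduct.map_comp, TensorProduct.map_comp]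
  rfl

lemma map_sum_left_aux {ι : Type} [Fintype ι] (u : ι → A →ₗ[R] P) (w : B →ₗ[R] Q)
    (m : C →ₗ[R] A ⊗[R] B) :
    TensorProduct.map (∑ h, u h) w ∘ₗ m = ∑ h, TensorProduct.map (u h) w ∘ₗ m :=
  (congrArg (fun x => x ∘ₗ m)
    (map_sum ((TensorProduct.mapBilinear (.id R) _ _ _ _).flip w) _ _)).trans
    (map_sum ((LinearMap.llcomp R _ _ _).flip m) _ _)

lemma map_sum_right_aux {ι : Type} [Fintype ι] (u : A →ₗ[R] P) (w : ι → B →ₗ[R] Q)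
    (m : C →ₗ[R] A ⊗[R] B) :
    TensorProduct.map u (∑ h, w h) ∘ₗ m = ∑ h, TensorProduct.map u (w h) ∘ₗ m :=
  (congrArg (fun x => x ∘ₗ m)
    (map_sum (TensorProduct.mapBilinear (.id R) _ _ _ _ u) _ _)).trans
    (map_sum ((LinearMap.llcomp R _ _ _).flip m) _ _)

lemma map_sub_left_aux (u u' : A →ₗ[R] P) (w : B →ₗ[R] Q) (m : C →ₗ[R] A ⊗[R] B) :
    TensorProduct.map (u - u') w ∘ₗ m
      = TensorProduct.map u w ∘ₗ m - TensorProduct.map u' w ∘ₗ m :=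
  (congrArg (fun x => x ∘ₗ m)
    (map_sub ((TensorProduct.mapBilinear (.id R) _ _ _ _).flip w) _ _)).trans
    (map_sub ((LinearMap.llcomp R _ _ _).flip m) _ _)

lemma map_sub_right_aux (u : A →ₗ[R] P) (w w' : B →ₗ[R] Q) (m : C →ₗ[R] A ⊗[R] B) :
    TensorProduct.map u (w - w') ∘ₗ m
      = TensorProduct.map u w ∘ₗ m - TensorProduct.map u w' ∘ₗ m :=
  (congrArg (fun x => x ∘ₗ m)
    (map_sub (TensorProduct.mapBilinear (.id R) _ _ _ _ u) _ _)).trans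
    (map_sub ((LinearMap.llcomp R _ _ _).flip m) _ _)

end MapAux

lemma cup_invariance {i j : ℤ} {M N : Rep ℤ G}
    (f : ((hRep (J G i) M).ρ.invariants))
    (g : ((hRep (J G j) N).ρ.invariants)) :
    (TensorProduct.map f.1 g.1).comp ((μ G i j).hom.toLinearMap)
      ∈ (hRep (J G (i + j)) (M ⊗ N)).ρ.invariants := by
  intro gg
  have hf : M.ρ gg ∘ₗ f.1 ∘ₗ (J G i).ρ gg⁻¹ = f.1 := f.2 gg
  have hg : N.ρ gg ∘ₗ g.1 ∘ₗ (J G j).ρ gg⁻¹ = g.1 := g.2 gg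
  have hμ : (μ G i j).hom.toLinearMap.comp ((J G (i + j)).ρ gg⁻¹)
      = (TensorProduct.map ((J G i).ρ gg⁻¹) ((J G j).ρ gg⁻¹)).comp (μ G i j).hom.toLinearMap := by
    have h := (μ G i j).hom.isIntertwining' gg⁻¹
    exact h
  show (M ⊗ N).ρ gg ∘ₗ ((TensorProduct.map f.1 g.1).comp (μ G i j).hom.toLinearMap)
        ∘ₗ (J G (i + j)).ρ gg⁻¹
      = (TensorProduct.map f.1 g.1).comp (μ G i j).hom.toLinearMap
  exact (map_conj_aux f.1 g.1 _ (M.ρ gg) (N.ρ gg) _ _ _ hμ).trans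
    (congrArg₂ (fun x y => (TensorProduct.map x y).comp (μ G i j).hom.toLinearMap) hf hg)

lemma conj_term {i j : ℤ} {M N : Rep ℤ G} (u : (J G i).V →ₗ[ℤ] M.V)
    (w : (J G j).V →ₗ[ℤ] N.V) (h : G) :
    (TensorProduct.map (M.ρ h ∘ₗ u ∘ₗ (J G i).ρ h⁻¹) (N.ρ h ∘ₗ w ∘ₗ (J G j).ρ h⁻¹)).comp
        (μ G i j).hom.toLinearMap
      = ((hRep (J G (i + j)) (M ⊗ N)).ρ h) ((TensorProduct.map u w).comp (μ G i j).hom.toLinearMap) := by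
  have hμ : (μ G i j).hom.toLinearMap ∘ₗ (J G (i + j)).ρ h⁻¹
      = TensorProduct.map ((J G i).ρ h⁻¹) ((J G j).ρ h⁻¹) ∘ₗ (μ G i j).hom.toLinearMap := by
    have hc := (μ G i j).hom.isIntertwining' h⁻¹
    exact hc
  show _ = (M ⊗ N).ρ h ∘ₗ ((TensorProduct.map u w).comp (μ G i j).hom.toLinearMap) ∘ₗ (J G (i + j)).ρ h⁻¹
  rw [LinearMap.comp_assoc, hμ, ← LinearMap.comp_assoc, ← LinearMap.comp_assoc]
  rw [TensorProduct.map_comp, TensorProduct.map_comp]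
  rfl

lemma cup_norm_left {i j : ℤ} {M N : Rep ℤ G} (u : (J G i).V →ₗ[ℤ] M.V)
    (g : ((hRep (J G j) N).ρ.invariants)) :
    (TensorProduct.map (rnorm ((hRep (J G i) M).ρ) u) g.1).comp (μ G i j).hom.toLinearMap
      = rnorm ((hRep (J G (i + j)) (M ⊗ N)).ρ)
          ((TensorProduct.map u g.1).comp (μ G i j).hom.toLinearMap) := by
  have h1 : rnorm ((hRep (J G i) M).ρ) u = ∑ h : G, ((hRep (J G i) M).ρ h) u := by
    exact LinearMap.sum_apply _ _ _
  have h2 : rnorm ((hRep (J G (i + j)) (M ⊗ N)).ρ) ((TensorProduct.map u g.1).comp (μ G i j).hom.toLinearMap)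
      = ∑ h : G, ((hRep (J G (i + j)) (M ⊗ N)).ρ h)
          ((TensorProduct.map u g.1).comp (μ G i j).hom.toLinearMap) := by
    exact LinearMap.sum_apply _ _ _
  rw [h1, h2]
  refine (map_sum_left_aux (fun h : G => ((hRep (J G i) M).ρ h) u) g.1 _).trans ?_
  refine Finset.sum_congr rfl fun h _ => ?_
  have hginv : N.ρ h ∘ₗ g.1 ∘ₗ (J G j).ρ h⁻¹ = g.1 := g.2 h
  rw [← conj_term u g.1 h, hginv]
  rfl

lemma cup_norm_right {i j : ℤ} {M N : Rep ℤ G}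
    (f : ((hRep (J G i) M).ρ.invariants)) (w : (J G j).V →ₗ[ℤ] N.V) :
    (TensorProduct.map f.1 (rnorm ((hRep (J G j) N).ρ) w)).comp (μ G i j).hom.toLinearMap
      = rnorm ((hRep (J G (i + j)) (M ⊗ N)).ρ)
          ((TensorProduct.map f.1 w).comp (μ G i j).hom.toLinearMap) := by
  have h1 : rnorm ((hRep (J G j) N).ρ) w = ∑ h : G, ((hRep (J G j) N).ρ h) w := by
    exact LinearMap.sum_apply _ _ _
  have h2 : rnorm ((hRep (J G (i + j)) (M ⊗ N)).ρ) ((TensorProduct.map f.1 w).comp (μ G i j).hom.toLinearMap)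
      = ∑ h : G, ((hRep (J G (i + j)) (M ⊗ N)).ρ h)
          ((TensorProduct.map f.1 w).comp (μ G i j).hom.toLinearMap) := by
    exact LinearMap.sum_apply _ _ _
  rw [h1, h2]
  refine (map_sum_right_aux f.1 (fun h : G => ((hRep (J G j) N).ρ h) w) _).trans ?_
  refine Finset.sum_congr rfl fun h _ => ?_
  have hfinv : M.ρ h ∘ₗ f.1 ∘ₗ (J G i).ρ h⁻¹ = f.1 := f.2 h
  rw [← conj_term f.1 w h, hfinv]
  rfl

lemma cup_welldef {i j : ℤ} {M N : Rep ℤ G}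
    (a₁ : ((hRep (J G i) M).ρ.invariants)) (b₁ : ((hRep (J G j) N).ρ.invariants))
    (a₂ : ((hRep (J G i) M).ρ.invariants)) (b₂ : ((hRep (J G j) N).ρ.invariants))
    (ha : a₁ - a₂ ∈ rnormIm ((hRep (J G i) M).ρ))
    (hb : b₁ - b₂ ∈ rnormIm ((hRep (J G j) N).ρ)) :
    tate0mk (ρ := (hRep (J G (i + j)) (M ⊗ N)).ρ) ((TensorProduct.map a₁.1 b₁.1).comp ((μ G i j).hom.toLinearMap)) (cup_invariance a₁ b₁)
      = tate0mk (ρ := (hRep (J G (i + j)) (M ⊗ N)).ρ) ((TensorProduct.map a₂.1 b₂.1).comp ((μ G i j).hom.toLinearMap)) (cup_invariance a₂ b₂) := by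
  obtain ⟨u, hu⟩ := ha
  obtain ⟨w, hw⟩ := hb
  have hu' : rnorm ((hRep (J G i) M).ρ) u = a₁.1 - a₂.1 := congrArg Subtype.val hu
  have hw' : rnorm ((hRep (J G j) N).ρ) w = b₁.1 - b₂.1 := congrArg Subtype.val hw
  have step1 : tate0mk (ρ := (hRep (J G (i + j)) (M ⊗ N)).ρ) ((TensorProduct.map a₁.1 b₁.1).comp ((μ G i j).hom.toLinearMap))
        (cup_invariance a₁ b₁)
      = tate0mk (ρ := (hRep (J G (i + j)) (M ⊗ N)).ρ) ((TensorProduct.map a₂.1 b₁.1).comp ((μ G i j).hom.toLinearMap)) (cup_invariance a₂ b₁) := by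
    refine (Submodule.Quotient.eq _).mpr ?_
    refine ⟨(TensorProduct.map u b₁.1).comp ((μ G i j).hom.toLinearMap), ?_⟩
    apply Subtype.ext
    have key := cup_norm_left u b₁
    rw [hu'] at key
    refine key.symm.trans ?_
    show _ = (TensorProduct.map a₁.1 b₁.1).comp ((μ G i j).hom.toLinearMap)
        - (TensorProduct.map a₂.1 b₁.1).comp ((μ G i j).hom.toLinearMap)
    exact map_sub_left_aux a₁.1 a₂.1 b₁.1 _
  have step2 : tate0mk (ρ := (hRep (J G (i + j)) (M ⊗ N)).ρ) ((TensorProduct.map a₂.1 b₁.1).comp ((μ G i j).hom.toLinearMap))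
        (cup_invariance a₂ b₁)
      = tate0mk (ρ := (hRep (J G (i + j)) (M ⊗ N)).ρ) ((TensorProduct.map a₂.1 b₂.1).comp ((μ G i j).hom.toLinearMap)) (cup_invariance a₂ b₂) := by
    refine (Submodule.Quotient.eq _).mpr ?_
    refine ⟨(TensorProduct.map a₂.1 w).comp ((μ G i j).hom.toLinearMap), ?_⟩
    apply Subtype.ext
    have key := cup_norm_right a₂ w
    rw [hw'] at key
    refine key.symm.trans ?_
    show _ = (TensorProduct.map a₂.1 b₁.1).comp ((μ G i j).hom.toLinearMap)
        - (TensorProduct.map a₂.1 b₂.1).comp ((μ G i j).hom.toLinearMap)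
    exact map_sub_right_aux a₂.1 b₁.1 b₂.1 _
  exact step1.trans step2

/-- The cup product `Ĥ^i(G, M) × Ĥ^j(G, N) → Ĥ^{i+j}(G, M ⊗ N)` on Tate cohomology,
induced by the comparison maps `μ`. -/
noncomputable def cup {i j : ℤ} {M N : Rep ℤ G} (z₁ : tate i M) (z₂ : tate j N) :
    tate (i + j) (M ⊗ N) :=
  Quotient.liftOn₂ z₁ z₂
    (fun f g => tate0mk (ρ := (hRep (J G (i + j)) (M ⊗ N)).ρ) ((TensorProduct.map f.1 g.1).comp ((μ G i j).hom.toLinearMap)) (cup_invariance f g))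
    (fun a₁ b₁ a₂ b₂ ha hb => cup_welldef a₁ b₁ a₂ b₂
      ((Submodule.quotientRel_def _).mp ha) ((Submodule.quotientRel_def _).mp hb))

/-! ### Pairings -/

/-- The composition pairing `Hom_ℤ(B, C) ⊗ Hom_ℤ(A, B) ⟶ Hom_ℤ(A, C)`, `f ⊗ φ ↦ f ∘ φ`. -/
noncomputable def compPair (A B C : Rep ℤ G) : hRep B C ⊗ hRep A B ⟶ hRep A C :=
  MonoidalClosed.curry <|
    (A ◁ (β_ (hRep B C) (hRep A B)).hom) ≫ (α_ A (hRep A B) (hRep B C)).inv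
      ≫ (((ihom.ev A).app B) ▷ hRep B C) ≫ (ihom.ev B).app C

/-- The evaluation pairing `Hom_ℤ(X, B) ⊗ X ⟶ B`, `f ⊗ x ↦ f x`. -/
noncomputable def evPair (X B : Rep ℤ G) : hRep X B ⊗ X ⟶ B :=
  (β_ (hRep X B) X).hom ≫ (ihom.ev X).app B

/-- The cup product `Ĥ^i(G, Hom(X, A)) × Ĥ^j(G, Hom(X', X)) → Ĥ^{i+j}(G, Hom(X', A))`
induced by the composition pairing. -/
noncomputable def ccup {i j : ℤ} {X X' A : Rep ℤ G}
    (z : tate i (hRep X A)) (x : tate j (hRep X' X)) : tate (i + j) (hRep X' A) :=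
  tmap (i + j) (compPair X' X A) (cup z x)

/-- `ccup`, with the degree of the target adjusted along an equality of integers. -/
noncomputable def ccupTo {i j m : ℤ} {X X' A : Rep ℤ G}
    (z : tate i (hRep X A)) (x : tate j (hRep X' X)) (h : i + j = m) :
    tate m (hRep X' A) :=
  tcast h (ccup z x)

/-- The class of the identity in `Ĥ⁰(G, Hom_ℤ(X, X))`. -/
noncomputable def idCls (X : Rep ℤ G) : tate 0 (hRep X X) :=
  mkCls (MonoidalClosed.curry (ρ_ X).hom)

/-! ### Encoding pairs and related notions -/

/-- `(X, X')` is an *`r`-encoding pair* if for some `i ∈ ℤ` there is a natural isomorphism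
of functors `Ĥ^i(G, Hom_ℤ(X, -)) ≅ Ĥ^{i+r}(G, Hom_ℤ(X', -))` on `Rep ℤ G`. -/
def IsEncodingPair {G : Type} [Group G] [Fintype G] (r : ℤ) (X X' : Rep ℤ G) : Prop :=
  ∃ (i : ℤ) (e : ∀ A : Rep ℤ G, tate i (hRep X A) ≃+ tate (i + r) (hRep X' A)),
    ∀ {A B : Rep ℤ G} (φ : A ⟶ B) (z : tate i (hRep X A)),
      e B (tmap i ((Rep.ihom X).map φ) z) = tmap (i + r) ((Rep.ihom X').map φ) (e A z)

/-- `x ∈ Ĥ^r(G, Hom_ℤ(X', X))` is an *encoding element* for the pair `(X, X')` if it has a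
*decoding element* `x' ∈ Ĥ^{-r}(G, Hom_ℤ(X, X'))` with `x' ∪ x = [id_{X'}]` and
`x ∪ x' = [id_X]`. -/
def IsEncodingElement {G : Type} [Group G] [Fintype G] {r : ℤ} (X X' : Rep ℤ G)
    (x : tate r (hRep X' X)) : Prop :=
  ∃ x' : tate (-r) (hRep X X'),
    ccupTo x' x (by ring) = idCls X' ∧ ccupTo x x' (by ring) = idCls X

/-- The induced `G`-module `ℤ[G] ⊗_ℤ A ≅ (G →₀ A)`, with `G` acting by left translation. -/
noncomputable def indRep (G : Type) [Group G] (A : Type) [AddCommGroup A] [Module ℤ A] :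
    Rep ℤ G :=
  Rep.of (G := G) (X := G →₀ A)
    { toFun := fun g => Finsupp.lmapDomain A ℤ (fun h => g * h)
      map_one' := by
        ext x h
        simp [Finsupp.lmapDomain_apply, Finsupp.mapDomain_id, one_mul]
      map_mul' := fun g g' => by
        ext x h
        simp [Finsupp.lmapDomain_apply, Module.End.mul_apply, Finsupp.mapDomain_single,
          mul_assoc] }

/-- A `G`-module is *induced* if it is isomorphic to `ℤ[G] ⊗_ℤ A` for some abelian group `A`. -/
def IsInduced {G : Type} [Group G] (M : Rep ℤ G) : Prop :=
  ∃ (A : Type) (_ : AddCommGroup A) (_ : Module ℤ A), Nonempty (M ≅ indRep G A)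

/-- A class `φ ∈ Ĥ⁰(G, Hom_ℤ(X, X))` is a unit for the (composition) cup product. -/
def IsUnitCls {G : Type} [Group G] [Fintype G] {X : Rep ℤ G}
    (φ : tate 0 (hRep X X)) : Prop :=
  ∃ ψ : tate 0 (hRep X X),
    ccupTo φ ψ (by ring) = idCls X ∧ ccupTo ψ φ (by ring) = idCls X


/-- The natural map `Hom_ℤ(X, A) ⊗ I_G ⟶ Hom_ℤ(X, A ⊗ I_G)`, `f ⊗ z ↦ (x ↦ f x ⊗ z)`. -/
noncomputable def pr0 (X A : Rep ℤ G) : hRep X A ⊗ IGrep G ⟶ hRep X (A ⊗ IGrep G) :=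
  MonoidalClosed.curry ((α_ X (hRep X A) (IGrep G)).inv ≫ ((ihom.ev X).app A ▷ IGrep G))

/-- The natural evaluation map `Hom_ℤ(X, Hom_ℤ(I_G, A)) ⊗ I_G ⟶ Hom_ℤ(X, A)`,
`f ⊗ z ↦ (x ↦ f x z)`. -/
noncomputable def pr1 (X A : Rep ℤ G) :
    hRep X (hRep (IGrep G) A) ⊗ IGrep G ⟶ hRep X A :=
  MonoidalClosed.curry ((α_ X (hRep X (hRep (IGrep G) A)) (IGrep G)).inv
    ≫ ((ihom.ev X).app (hRep (IGrep G) A) ▷ IGrep G) ≫ evPair (IGrep G) A)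

/-- The natural evaluation map `Hom_ℤ(X', X) ⊗ (X' ⊗ A) ⟶ X ⊗ A`. -/
noncomputable def tPair (X' X A : Rep ℤ G) : hRep X' X ⊗ (X' ⊗ A) ⟶ X ⊗ A :=
  (α_ (hRep X' X) X' A).inv ≫ (evPair X' X ▷ A)

/-- A functor `Rep ℤ G ⥤ Rep ℤ G` sends `ℤ`-split short exact sequences of `G`-modules to
short exact sequences of `G`-modules. -/
def PreservesZSplitSES {G : Type} [Group G] (F : Rep.{0} ℤ G ⥤ Rep.{0} ℤ G) : Prop :=
  ∀ (A B C : Rep ℤ G) (f : A ⟶ B) (g : B ⟶ C),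
    Function.Injective f.hom → Function.Surjective g.hom → Function.Exact f.hom g.hom →
    (∃ s : C.V →+ B.V, ∀ x, g.hom (s x) = x) →
    Function.Injective (F.map f).hom ∧ Function.Surjective (F.map g).hom ∧
      Function.Exact (F.map f).hom (F.map g).hom

/-- A *shiftable functor*: it sends `ℤ`-split short exact sequences of `G`-modules to short
exact sequences, and sends induced modules to induced modules. -/
def Shiftable {G : Type} [Group G] (F : Rep ℤ G ⥤ Rep ℤ G) : Prop :=
  PreservesZSplitSES F ∧ ∀ M : Rep ℤ G, IsInduced M → IsInduced (F.obj M)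

end Enc

open CategoryTheory MonoidalCategory Enc

namespace EncP

section Stable
variable {G : Type} [Group G] [Fintype G]

/-- A morphism of representations is null if it is the norm of a linear map. -/
def Null {A B : Rep.{0} ℤ G} (f : A ⟶ B) : Prop :=
  ∃ h : A.V →ₗ[ℤ] B.V, ∀ v : A.V, f.hom v = ∑ g : G, B.ρ g (h (A.ρ g⁻¹ v))

lemma Null.add {A B : Rep.{0} ℤ G} {f f' : A ⟶ B} (hf : Null f) (hf' : Null f') :
    Null (f + f') := by
  obtain ⟨h, hh⟩ := hf
  obtain ⟨h', hh'⟩ := hf'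
  refine ⟨h + h', fun v => ?_⟩
  have : (f + f').hom v = f.hom v + f'.hom v := rfl
  rw [this, hh, hh', ← Finset.sum_add_distrib]
  refine Finset.sum_congr rfl fun g _ => ?_
  rw [LinearMap.add_apply, map_add]

lemma Null.neg {A B : Rep.{0} ℤ G} {f : A ⟶ B} (hf : Null f) : Null (-f) := by
  obtain ⟨h, hh⟩ := hf
  refine ⟨-h, fun v => ?_⟩
  have : (-f).hom v = -f.hom v := rfl
  rw [this, hh, ← Finset.sum_neg_distrib]
  refine Finset.sum_congr rfl fun g _ => ?_
  rw [LinearMap.neg_apply, map_neg]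

lemma Null.zero {A B : Rep.{0} ℤ G} : Null (0 : A ⟶ B) := by
  refine ⟨0, fun v => ?_⟩
  have : (0 : A ⟶ B).hom v = 0 := rfl
  rw [this]
  simp

lemma Null.comp_left {A B C : Rep.{0} ℤ G} (e : A ⟶ B) {f : B ⟶ C} (hf : Null f) :
    Null (e ≫ f) := by
  obtain ⟨h, hh⟩ := hf
  refine ⟨h ∘ₗ e.hom.toLinearMap, fun v => ?_⟩
  have : (e ≫ f).hom v = f.hom (e.hom v) := rfl
  rw [this, hh]
  refine Finset.sum_congr rfl fun g _ => ?_
  have h2 : (h ∘ₗ e.hom.toLinearMap) (A.ρ g⁻¹ v) = h (e.hom (A.ρ g⁻¹ v)) := rfl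
  rw [h2, Rep.hom_comm_apply]

lemma Null.comp_right {A B C : Rep.{0} ℤ G} {f : A ⟶ B} (hf : Null f) (e : B ⟶ C) :
    Null (f ≫ e) := by
  obtain ⟨h, hh⟩ := hf
  refine ⟨e.hom.toLinearMap ∘ₗ h, fun v => ?_⟩
  have : (f ≫ e).hom v = e.hom (f.hom v) := rfl
  rw [this, hh, map_sum]
  refine Finset.sum_congr rfl fun g _ => ?_
  have h2 : (e.hom.toLinearMap ∘ₗ h) (A.ρ g⁻¹ v) = e.hom (h (A.ρ g⁻¹ v)) := rfl
  rw [h2, Rep.hom_comm_apply]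

lemma Null.whiskerRight {A B : Rep.{0} ℤ G} {f : A ⟶ B} (hf : Null f) (C : Rep.{0} ℤ G) :
    Null (f ▷ C) := by
  obtain ⟨h, hh⟩ := hf
  refine ⟨TensorProduct.map h LinearMap.id, fun v => ?_⟩
  induction v using TensorProduct.induction_on with
  | zero => simp
  | add x y hx hy =>
    simp only [map_add, Finset.sum_add_distrib]
    rw [← hx, ← hy]
  | tmul a c =>
    have h1 : (f ▷ C).hom (a ⊗ₜ[ℤ] c) = (f.hom a) ⊗ₜ[ℤ] c := rfl
    refine h1.trans ?_
    rw [hh, TensorProduct.sum_tmul]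
    refine Finset.sum_congr rfl fun g _ => ?_
    have h2 : (B ⊗ C).ρ g (TensorProduct.map h LinearMap.id ((A ⊗ C).ρ g⁻¹ (a ⊗ₜ[ℤ] c)))
      = (B.ρ g (h (A.ρ g⁻¹ a))) ⊗ₜ[ℤ] (C.ρ g (C.ρ g⁻¹ c)) := rfl
    refine Eq.trans ?_ h2.symm
    rw [Representation.self_inv_apply]

lemma Null.whiskerLeft {A B : Rep.{0} ℤ G} {f : A ⟶ B} (hf : Null f) (C : Rep.{0} ℤ G) :
    Null (C ◁ f) := by
  have : C ◁ f = (β_ C A).hom ≫ (f ▷ C) ≫ (β_ B C).hom := by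
    rw [BraidedCategory.braiding_naturality_left]
    simp
  rw [this]
  exact ((hf.whiskerRight C).comp_right _).comp_left _

lemma null_card {A : Rep.{0} ℤ G} : Null ((Fintype.card G : ℤ) • 𝟙 A) := by
  refine ⟨LinearMap.id, fun v => ?_⟩
  have : ((Fintype.card G : ℤ) • 𝟙 A).hom v = (Fintype.card G : ℤ) • v := rfl
  rw [this]
  simp

/-- The stable relation. -/
def stRel (G : Type) [Group G] [Fintype G] : HomRel (Rep.{0} ℤ G) := fun _ _ f g => Null (f - g)

instance : Congruence (stRel G) where
  equivalence := ⟨fun f => by unfold stRel; rw [sub_self]; exact Null.zero,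
    fun {f g} h => by unfold stRel at *; rw [← neg_sub]; exact h.neg,
    fun {f g k} h h' => by unfold stRel at *; rw [← sub_add_sub_cancel]; exact h.add h'⟩
  comp_left := by
    intro _ _ _ f g g' h
    unfold stRel at *; rw [← Preadditive.comp_sub]; exact h.comp_left _
  comp_right := by
    intro _ _ _ f f' g h
    unfold stRel at *; rw [← Preadditive.sub_comp]; exact h.comp_right g

lemma stRel_add : ∀ ⦃X Y : Rep.{0} ℤ G⦄ (f₁ f₂ g₁ g₂ : X ⟶ Y) (_ : stRel G f₁ f₂)
    (_ : stRel G g₁ g₂), stRel G (f₁ + g₁) (f₂ + g₂) := by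
  intro X Y f₁ f₂ g₁ g₂ h h'
  unfold stRel at *
  rw [add_sub_add_comm]
  exact h.add h'

/-- The stable category. -/
abbrev St (G : Type) [Group G] [Fintype G] := Quotient (stRel G)

noncomputable instance : Preadditive (St G) := Quotient.preadditive (stRel G) stRel_add

/-- The quotient functor. -/
noncomputable abbrev Q (G : Type) [Group G] [Fintype G] : Rep.{0} ℤ G ⥤ St G :=
  Quotient.functor (stRel G)

instance : (Q G).Additive := Quotient.functor_additive (stRel G) stRel_add

lemma Q_eq_iff {A B : Rep.{0} ℤ G} (f g : A ⟶ B) : (Q G).map f = (Q G).map g ↔ Null (f - g) :=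
  Quotient.functor_map_eq_iff _ _ _

lemma Q_zero_iff {A B : Rep.{0} ℤ G} (f : A ⟶ B) : (Q G).map f = 0 ↔ Null f := by
  rw [← (Q G).map_zero, Q_eq_iff, sub_zero]

lemma st_card {A B : St G} (f : A ⟶ B) : (Fintype.card G : ℤ) • f = 0 := by
  obtain ⟨f, rfl⟩ := (Q G).map_surjective (X := A.as) (Y := B.as) f
  have : (Q G).map ((Fintype.card G : ℤ) • 𝟙 A.as) = 0 := (Q_zero_iff _).2 null_card
  have h2 : (Fintype.card G : ℤ) • f = ((Fintype.card G : ℤ) • 𝟙 A.as) ≫ f := by simp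
  rw [← Functor.map_zsmul, h2, Functor.map_comp, this, Limits.zero_comp]

/-- Tensoring on the right in the stable category. -/
noncomputable def TR (C : Rep.{0} ℤ G) : St G ⥤ St G :=
  CategoryTheory.Quotient.lift (stRel G) (tensorRight C ⋙ Q G) (by
    intro A B f g h
    refine (Q_eq_iff _ _).2 ?_
    have : (tensorRight C).map f - (tensorRight C).map g = (f - g) ▷ C :=
      ((tensorRight C).map_sub).symm
    rw [this]
    exact Null.whiskerRight h C)

lemma TR_map (C : Rep.{0} ℤ G) {A B : Rep.{0} ℤ G} (f : A ⟶ B) :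
    (TR C).map ((Q G).map f) = (Q G).map (f ▷ C) := rfl

/-- Stable isomorphism. -/
def SI (A B : Rep.{0} ℤ G) : Prop := Nonempty ((Q G).obj A ≅ (Q G).obj B)

lemma SI.refl (A : Rep.{0} ℤ G) : SI A A := ⟨Iso.refl _⟩
lemma SI.symm {A B : Rep.{0} ℤ G} (h : SI A B) : SI B A := ⟨h.some.symm⟩
lemma SI.trans {A B C : Rep.{0} ℤ G} (h : SI A B) (h' : SI B C) : SI A C :=
  ⟨h.some ≪≫ h'.some⟩
lemma SI.of_iso {A B : Rep.{0} ℤ G} (h : A ≅ B) : SI A B := ⟨(Q G).mapIso h⟩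
lemma SI.of_eq {A B : Rep.{0} ℤ G} (h : A = B) : SI A B := h ▸ SI.refl A

lemma SI.of_null {A B : Rep.{0} ℤ G} (f : A ⟶ B) (g : B ⟶ A) (h : Null (f ≫ g - 𝟙 A))
    (h' : Null (g ≫ f - 𝟙 B)) : SI A B :=
  ⟨⟨(Q G).map f, (Q G).map g,
    by rw [← Functor.map_comp, ← CategoryTheory.Functor.map_id]; exact (Q_eq_iff _ _).2 h,
    by rw [← Functor.map_comp, ← CategoryTheory.Functor.map_id]; exact (Q_eq_iff _ _).2 h'⟩⟩

lemma SI.exists_hom {A B : Rep.{0} ℤ G} (h : SI A B) : ∃ (f : A ⟶ B) (g : B ⟶ A),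
    Null (f ≫ g - 𝟙 A) ∧ Null (g ≫ f - 𝟙 B) := by
  obtain ⟨e⟩ := h
  obtain ⟨f, hf⟩ := (Q G).map_surjective e.hom
  obtain ⟨g, hg⟩ := (Q G).map_surjective e.inv
  refine ⟨f, g, (Q_eq_iff _ _).1 ?_, (Q_eq_iff _ _).1 ?_⟩
  · rw [Functor.map_comp, hf, hg, e.hom_inv_id, CategoryTheory.Functor.map_id]
  · rw [Functor.map_comp, hf, hg, e.inv_hom_id, CategoryTheory.Functor.map_id]

lemma SI.tensorRight {A B : Rep.{0} ℤ G} (h : SI A B) (C : Rep.{0} ℤ G) : SI (A ⊗ C) (B ⊗ C) :=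
  ⟨(TR C).mapIso h.some⟩

lemma SI.tensorLeft {A B : Rep.{0} ℤ G} (h : SI A B) (C : Rep.{0} ℤ G) : SI (C ⊗ A) (C ⊗ B) :=
  (SI.of_iso (β_ C A)).trans ((h.tensorRight C).trans (SI.of_iso (β_ B C)))

/-- Compatibility of `TR` with stable isomorphisms. -/
noncomputable def TRcongr {C D : Rep.{0} ℤ G} (f : C ⟶ D) (g : D ⟶ C)
    (h : Null (f ≫ g - 𝟙 C)) (h' : Null (g ≫ f - 𝟙 D)) : TR C ≅ TR D :=
  Quotient.natIsoLift (stRel G) (NatIso.ofComponents (fun A =>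
    { hom := (Q G).map (A ◁ f)
      inv := (Q G).map (A ◁ g)
      hom_inv_id := by
        have e : A ◁ f ≫ A ◁ g - 𝟙 _ = A ◁ (f ≫ g - 𝟙 C) := by
          rw [← MonoidalCategory.whiskerLeft_comp, ← MonoidalCategory.whiskerLeft_id]
          exact ((tensorLeft A).map_sub).symm
        refine ((Q G).map_comp _ _).symm.trans (Eq.trans ?_ ((Q G).map_id _))
        refine (Q_eq_iff _ _).2 ?_
        exact e ▸ h.whiskerLeft A
      inv_hom_id := by
        have e : A ◁ g ≫ A ◁ f - 𝟙 _ = A ◁ (g ≫ f - 𝟙 D) := by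
          rw [← MonoidalCategory.whiskerLeft_comp, ← MonoidalCategory.whiskerLeft_id]
          exact ((tensorLeft A).map_sub).symm
        refine ((Q G).map_comp _ _).symm.trans (Eq.trans ?_ ((Q G).map_id _))
        refine (Q_eq_iff _ _).2 ?_
        exact e ▸ h'.whiskerLeft A })
    (fun {A B} u => by
      refine ((Q G).map_comp (u ▷ C) (B ◁ f)).symm.trans
        (Eq.trans ?_ ((Q G).map_comp (A ◁ f) (u ▷ D)))
      rw [whisker_exchange]))

/-- `TR` of a tensor product. -/
noncomputable def TRcomp (C D : Rep.{0} ℤ G) : TR C ⋙ TR D ≅ TR (C ⊗ D) :=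
  Quotient.natIsoLift (stRel G) (NatIso.ofComponents (fun A => (Q G).mapIso (α_ A C D))
    (fun {A B} u => by
      refine ((Q G).map_comp ((u ▷ C) ▷ D) (α_ B C D).hom).symm.trans
        (Eq.trans ?_ ((Q G).map_comp (α_ A C D).hom (u ▷ (C ⊗ D))))
      rw [associator_naturality_left]))

/-- `TR` of the unit. -/
noncomputable def TRunit : TR (𝟙_ (Rep.{0} ℤ G)) ≅ 𝟭 (St G) :=
  Quotient.natIsoLift (stRel G) (NatIso.ofComponents (fun A => (Q G).mapIso (ρ_ A))
    (fun {A B} u => by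
      refine ((Q G).map_comp (u ▷ _) (ρ_ B).hom).symm.trans
        (Eq.trans ?_ ((Q G).map_comp (ρ_ A).hom u))
      rw [rightUnitor_naturality]))

lemma TR_equiv {C D : Rep.{0} ℤ G} (h : SI (C ⊗ D) (𝟙_ _)) : (TR C).IsEquivalence := by
  have aux : ∀ {C D : Rep.{0} ℤ G}, SI (C ⊗ D) (𝟙_ _) → Nonempty (TR C ⋙ TR D ≅ 𝟭 _) := by
    intro C D h
    obtain ⟨f, g, h1, h2⟩ := h.exists_hom
    exact ⟨TRcomp C D ≪≫ TRcongr f g h1 h2 ≪≫ TRunit⟩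
  have h' : SI (D ⊗ C) (𝟙_ _) := (SI.of_iso (β_ D C)).trans h
  obtain ⟨a⟩ := aux h
  obtain ⟨b⟩ := aux h'
  exact (CategoryTheory.Equivalence.mk (TR C) (TR D) a.symm b).isEquivalence_functor

end Stable

section Aug
variable {G : Type} [Group G] [Fintype G]

/-- The element `k - g` of the augmentation ideal. -/
noncomputable def dv (g k : G) : IGcar G :=
  ⟨Finsupp.single k 1 - Finsupp.single g 1, by simp [aug]⟩

/-- The coordinate functions on the augmentation ideal. -/
noncomputable def cd (k : G) : IGcar G →ₗ[ℤ] ℤ :=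
  Finsupp.lapply k ∘ₗ (LinearMap.ker (aug G)).subtype

lemma cd_sum (v : IGcar G) : ∑ k : G, cd k v = 0 := by
  have h := v.2
  rw [LinearMap.mem_ker] at h
  unfold aug at h
  rw [Finsupp.linearCombination_apply, Finsupp.sum_fintype _ _ (by simp)] at h
  simp only [smul_eq_mul, mul_one] at h
  exact h

lemma dv_sum (x : G) (v : IGcar G) : ∑ k : G, cd k v • dv x k = v := by
  classical
  have h := cd_sum v
  apply Subtype.ext
  ext y
  have e : ((∑ k : G, cd k v • dv x k : IGcar G) : G →₀ ℤ) y
      = ∑ k : G, cd k v * ((dv x k : IGcar G) : G →₀ ℤ) y := by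
    simp [Finsupp.finsetSum_apply]
  rw [e]
  simp only [dv, Finsupp.sub_apply, mul_sub, Finset.sum_sub_distrib, ← Finset.sum_mul, h]
  simp [Finsupp.single_apply, cd]

lemma dv_sub (x g k : G) : dv g k = dv x k - dv x g := by
  apply Subtype.ext
  simp [dv]

lemma dv_act (g a b : G) : IGρ G g (dv a b) = dv (g * a) (g * b) := by
  apply Subtype.ext
  show Finsupp.mapDomain _ _ = _
  simp [dv, sub_eq_add_neg, Finsupp.mapDomain_add, ← Finsupp.single_neg,
    Finsupp.mapDomain_single]

lemma cd_act (g k : G) (a : IGcar G) : cd k (IGρ G g⁻¹ a) = cd (g * k) a := by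
  show Finsupp.mapDomain (g⁻¹ • ·) (a : G →₀ ℤ) k = (a : G →₀ ℤ) (g * k)
  have : k = g⁻¹ • (g * k) := by simp
  conv_lhs => rw [this]
  exact Finsupp.mapDomain_apply (MulAction.injective g⁻¹) _ _

/-- The contracting linear map. -/
noncomputable def hh : IGcar G ⊗[ℤ] Module.Dual ℤ (IGcar G) →ₗ[ℤ]
    IGcar G ⊗[ℤ] Module.Dual ℤ (IGcar G) :=
  ∑ k : G, (LinearMap.toSpanSingleton ℤ _ (dv 1 k ⊗ₜ[ℤ] cd k)) ∘ₗ
    (LinearMap.mul' ℤ ℤ ∘ₗ TensorProduct.map (cd 1) (LinearMap.applyₗ (dv k 1)))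

lemma hh_apply (a : IGcar G) (f : Module.Dual ℤ (IGcar G)) :
    hh (a ⊗ₜ[ℤ] f) = ∑ k : G, (cd 1 a * f (dv k 1)) • (dv 1 k ⊗ₜ[ℤ] cd k) := by
  simp [hh]

lemma coev_eq : (TensorProduct.comm ℤ _ _) (preElt G) = ∑ k : G, dv 1 k ⊗ₜ[ℤ] cd k := by
  have : preElt G = ∑ k : G, cd k ⊗ₜ[ℤ] dv 1 k := by
    unfold preElt
    rw [LinearEquiv.symm_apply_eq]
    ext1 v
    have := dv_sum 1 v
    simp [dualTensorHomEquiv, this]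
  rw [this, map_sum]
  rfl

lemma hh_norm (a : IGcar G) (f : Module.Dual ℤ (IGcar G)) :
    ∑ g : G, ∑ k : G, (cd g a * f (dv k g)) • (dv g k ⊗ₜ[ℤ] cd k)
      = a ⊗ₜ[ℤ] f + f a • (TensorProduct.comm ℤ _ _) (preElt G) := by
  apply (TensorProduct.comm ℤ _ _).injective
  apply (dualTensorHomEquiv ℤ (IGcar G) (IGcar G)).injective
  rw [coev_eq]
  ext1 v
  simp only [map_sum, map_add, TensorProduct.comm_tmul, LinearMap.sum_apply,
    LinearMap.add_apply, LinearMap.smul_apply, map_zsmul]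
  have key : ∀ (a : IGcar G) (φ : Module.Dual ℤ (IGcar G)) (v : IGcar G),
    dualTensorHomEquiv ℤ (IGcar G) (IGcar G) (φ ⊗ₜ[ℤ] a) v = φ v • a := fun a φ v => by
      simp [dualTensorHomEquiv]
  simp only [key, dv_sum]
  have e1 : ∀ g k : G, (cd g a * f (dv k g)) • cd k v • dv g k
      = (cd g a * f (dv k g)) • cd k v • dv 1 k - (cd k v * f (dv k g)) • cd g a • dv 1 g := by
    intro g k
    conv_lhs => rw [dv_sub 1 g k]
    module
  simp only [e1, Finset.sum_sub_distrib]
  rw [Finset.sum_comm]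
  have e2 : ∀ k : G, ∑ g : G, (cd g a * f (dv k g)) • cd k v • dv 1 k
      = f a • cd k v • dv 1 k := by
    intro k
    rw [← Finset.sum_smul]
    congr 1
    conv_rhs => rw [← dv_sum k a]
    simp
  have e3 : ∀ g : G, ∑ k : G, (cd k v * f (dv k g)) • cd g a • dv 1 g
      = (-(f v)) • cd g a • dv 1 g := by
    intro g
    rw [← Finset.sum_smul]
    congr 1
    conv_rhs => rw [← dv_sum g v]
    rw [map_sum, ← Finset.sum_neg_distrib]
    refine Finset.sum_congr rfl fun k _ => ?_
    have : dv k g = - dv g k := by rw [dv_sub 1 g k, dv_sub 1 k g]; abel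
    rw [this, map_neg, map_smul, smul_eq_mul]; ring
  simp only [e2, e3, ← Finset.smul_sum, dv_sum]
  module

lemma null_of_tmul {A B C : Rep.{0} ℤ G} (f : A ⊗ B ⟶ C) (h : A.V ⊗[ℤ] B.V →ₗ[ℤ] C.V)
    (hf : ∀ (a : A.V) (b : B.V), f.hom.toLinearMap (a ⊗ₜ[ℤ] b)
      = ∑ g : G, C.ρ g (h (A.ρ g⁻¹ a ⊗ₜ[ℤ] B.ρ g⁻¹ b))) : Null f := by
  refine ⟨h, fun v => ?_⟩
  have e : f.hom.toLinearMap = ∑ g : G, C.ρ g ∘ₗ h ∘ₗ (A ⊗ B).ρ g⁻¹ := by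
    apply TensorProduct.ext'
    intro a b
    rw [hf, LinearMap.sum_apply]
    rfl
  have := congrArg (fun φ => φ v) e
  refine Eq.trans this ?_
  rw [LinearMap.sum_apply]
  rfl

lemma hh_conj (a : IGcar G) (f : Module.Dual ℤ (IGcar G)) (g : G) :
    ∑ k : G, (cd g a * f (dv k g)) • (dv g k ⊗ₜ[ℤ] cd k) =
    TensorProduct.map (IGρ G g) ((IGρ G).dual g)
      (hh (IGρ G g⁻¹ a ⊗ₜ[ℤ] (IGρ G).dual g⁻¹ f)) := by
  rw [hh_apply, map_sum]
  refine Fintype.sum_equiv (Equiv.mulLeft g⁻¹) _ _ fun k => ?_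
  rw [map_zsmul, TensorProduct.map_tmul]
  have h2 : cd 1 (IGρ G g⁻¹ a) = cd g a := by rw [cd_act, mul_one]
  have h3 : (IGρ G).dual g⁻¹ f (dv (g⁻¹ * k) 1) = f (dv k g) := by
    have : (IGρ G).dual g⁻¹ f (dv (g⁻¹ * k) 1)
      = f (IGρ G g⁻¹⁻¹ (dv (g⁻¹ * k) 1)) := rfl
    rw [this, dv_act]
    simp
  have h5 : (IGρ G).dual g (cd (g⁻¹ * k)) = cd k := by
    apply LinearMap.ext
    intro v
    have : (IGρ G).dual g (cd (g⁻¹ * k)) v = cd (g⁻¹ * k) (IGρ G g⁻¹ v) := rfl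
    refine this.trans ?_
    rw [cd_act]
    simp
  have h6 : IGρ G g (dv 1 (g⁻¹ * k)) = dv g k := by
    rw [dv_act]
    simp
  rw [Equiv.coe_mulLeft, h2, h3, h5, h6]

/-- The evaluation map. -/
noncomputable def evI (G : Type) [Group G] [Fintype G] : IGrep G ⊗ DIG G ⟶ 𝟙_ (Rep.{0} ℤ G) :=
  (ihom.ev (IGrep G)).app (𝟙_ (Rep.{0} ℤ G))

lemma evI_apply (a : IGcar G) (f : Module.Dual ℤ (IGcar G)) :
    (evI G).hom ((show (IGrep G ⊗ DIG G : Rep ℤ G).V from (a ⊗ₜ[ℤ] f))) = f a := by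
  have := Rep.ihom_ev_app_hom (IGrep G) (𝟙_ (Rep.{0} ℤ G))
  exact congrArg (fun φ => φ (a ⊗ₜ[ℤ] f)) this

lemma coev_apply (z : ℤ) : (coev G).hom z = z • (TensorProduct.comm ℤ _ _) (preElt G) := rfl

lemma null_coev_ev : Null (coev G ≫ evI G + 𝟙 _) := by
  have : coev G ≫ evI G + 𝟙 _ = (Fintype.card G : ℤ) • 𝟙 (𝟙_ (Rep.{0} ℤ G)) := by
    apply Rep.hom_ext
    apply Representation.IntertwiningMap.ext
    apply LinearMap.ext
    intro (z : ℤ)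
    show (evI G).hom ((coev G).hom z) + z = (Fintype.card G : ℤ) • z
    have h1 : (coev G).hom z = ∑ k : G, (z • dv 1 k) ⊗ₜ[ℤ] cd k := by
      refine (coev_apply z).trans ?_
      rw [coev_eq, Finset.smul_sum]
      rfl
    have h2 : (evI G).hom ((coev G).hom z) = ∑ k : G, cd k (z • dv 1 k) := by
      rw [h1]
      refine (map_sum (evI G).hom.toLinearMap _ _).trans ?_
      exact Finset.sum_congr rfl fun k _ => evI_apply _ _
    rw [h2]
    have h3 : ∀ k : G, cd k (z • dv 1 k) = z * (1 - (Finsupp.single (1 : G) (1 : ℤ)) k) := by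
      intro k
      rw [map_smul]
      simp [cd, dv]
    simp only [h3, ← Finset.mul_sum, Finset.sum_sub_distrib]
    have h4 : ∑ k : G, (Finsupp.single (1 : G) (1 : ℤ)) k = 1 := by
      classical
      simp [Finsupp.single_apply]
    rw [h4]
    have h5 : (Fintype.card G : ℤ) • z = (Fintype.card G : ℤ) * z := rfl
    rw [h5]
    simp
    ring
  rw [this]
  exact null_card

lemma null_ev_coev : Null (evI G ≫ coev G + 𝟙 _) := by
  refine null_of_tmul _ hh fun a (f : Module.Dual ℤ (IGcar G)) => ?_
  refine Eq.trans ?_ ((hh_norm a f).symm.trans ?_)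
  · refine Eq.trans ?_ (add_comm _ _)
    have h1 := evI_apply a f
    have h2 := coev_apply (G := G) (f a)
    exact congrArg₂ (· + ·) ((congrArg (coev G).hom h1).trans h2) rfl
  · exact Finset.sum_congr rfl fun g _ => hh_conj a f g

lemma SI_IG_DIG : SI (IGrep G ⊗ DIG G) (𝟙_ (Rep.{0} ℤ G)) := by
  refine SI.of_null (evI G) (-coev G) ?_ ?_
  · have := (null_ev_coev (G := G)).neg
    rwa [neg_add', ← Preadditive.comp_neg] at this
  · have := (null_coev_ev (G := G)).neg
    rwa [neg_add', ← Preadditive.neg_comp] at this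

lemma SI_assoc_cancel {A C D : Rep.{0} ℤ G} (h : SI (C ⊗ D) (𝟙_ _)) : SI ((A ⊗ C) ⊗ D) A :=
  (SI.of_iso (α_ A C D)).trans ((h.tensorLeft A).trans (SI.of_iso (ρ_ A)))

lemma SI_DIG_IG : SI (DIG G ⊗ IGrep G) (𝟙_ (Rep.{0} ℤ G)) :=
  (SI.of_iso (β_ _ _)).trans SI_IG_DIG

lemma SI_J_succ (n : ℤ) : SI (J G (n + 1)) (J G n ⊗ IGrep G) := by
  match n with
  | .ofNat m => exact SI.refl _
  | .negSucc m =>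
    have e : Int.negSucc m + 1 = -(m : ℤ) := by omega
    rw [e, J_neg]
    exact (SI_assoc_cancel SI_DIG_IG).symm

lemma SI_J_pred (n : ℤ) : SI (J G (n - 1)) (J G n ⊗ DIG G) := by
  have h := SI_J_succ (G := G) (n - 1)
  rw [sub_add_cancel] at h
  exact ((h.tensorRight _).trans (SI_assoc_cancel SI_IG_DIG)).symm

lemma SI_J_add (i j : ℤ) : SI (J G (i + j)) (J G i ⊗ J G j) := by
  induction j with
  | zero =>
    rw [add_zero]
    exact SI.of_iso (ρ_ _).symm
  | succ j ih =>
    rw [← add_assoc]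
    exact (SI_J_succ _).trans ((ih.tensorRight _).trans ((SI.of_iso (α_ _ _ _)).trans
      ((SI_J_succ _).symm.tensorLeft _)))
  | pred j ih =>
    rw [← add_sub_assoc]
    exact (SI_J_pred _).trans ((ih.tensorRight _).trans ((SI.of_iso (α_ _ _ _)).trans
      ((SI_J_pred _).symm.tensorLeft _)))

lemma SI_J_neg (i : ℤ) : SI (J G i ⊗ J G (-i)) (𝟙_ (Rep.{0} ℤ G)) := by
  have h := SI_J_add (G := G) i (-i)
  rw [add_neg_cancel] at h
  exact h.symm

instance (i : ℤ) : (TR (J G i)).IsEquivalence := TR_equiv (SI_J_neg i)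

lemma tensor_free_aux {R M N : Type} [CommRing R] [AddCommGroup M] [AddCommGroup N]
    [Module R M] [Module R N] (hA : Module.Free R M) (hB : Module.Free R N) :
    Module.Free R (M ⊗[R] N) := inferInstance

lemma tensor_free {A B : Rep.{0} ℤ G} (hA : Module.Free ℤ A.V) (hB : Module.Free ℤ B.V) :
    Module.Free ℤ (A ⊗ B : Rep.{0} ℤ G).V :=
  tensor_free_aux hA hB

lemma J_free (i : ℤ) : Module.Free ℤ (J G i).V := by
  have hI : Module.Free ℤ (IGrep G).V := inferInstanceAs (Module.Free ℤ (IGcar G))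
  have hD : Module.Free ℤ (DIG G).V :=
    inferInstanceAs (Module.Free ℤ (IGcar G →ₗ[ℤ] ℤ))
  have hp : ∀ n, Module.Free ℤ (Jp G n).V := by
    intro n
    induction n with
    | zero => exact inferInstanceAs (Module.Free ℤ ℤ)
    | succ n ih => exact tensor_free ih hI
  have hn : ∀ n, Module.Free ℤ (Jn G n).V := by
    intro n
    induction n with
    | zero => exact inferInstanceAs (Module.Free ℤ ℤ)
    | succ n ih => exact tensor_free ih hD
  match i with
  | .ofNat m => exact hp m
  | .negSucc m => exact hn (m + 1)

end Aug

section Fin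
variable {G : Type} [Group G] [Fintype G]

lemma exists_equiv_of_ker {H T S : Type} [AddCommGroup H] [AddCommGroup T] [AddCommGroup S]
    (p : H →+ T) (q : H →+ S) (hp : Function.Surjective p) (hq : Function.Surjective q)
    (hk : ∀ h, p h = 0 ↔ q h = 0) : ∃ e : T ≃+ S, ∀ h, e (p h) = q h := by
  have hker : p.ker = q.ker := by
    ext h
    rw [AddMonoidHom.mem_ker, AddMonoidHom.mem_ker]
    exact hk h
  refine ⟨(QuotientAddGroup.quotientKerEquivOfSurjective p hp).symm.trans
    ((QuotientAddGroup.quotientAddEquivOfEq hker).trans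
      (QuotientAddGroup.quotientKerEquivOfSurjective q hq)), fun h => ?_⟩
  have : (QuotientAddGroup.quotientKerEquivOfSurjective p hp).symm (p h) = (h : H ⧸ p.ker) := by
    rw [AddEquiv.symm_apply_eq]
    rfl
  simp only [AddEquiv.trans_apply, this]
  rfl

/-- `mkCls` as an additive map. -/
noncomputable def mkHom (n : ℤ) (M : Rep.{0} ℤ G) : (J G n ⟶ M) →+ tate n M where
  toFun := mkCls
  map_zero' := rfl
  map_add' _ _ := rfl

lemma linHom_inv_aux {R A B : Type} [CommRing R] [AddCommGroup A] [AddCommGroup B] [Module R A]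
    [Module R B] (ρA : Representation R G A) (ρB : Representation R G B) (v : A →ₗ[R] B) (g : G)
    (h : (ρA.linHom ρB) g v = v) : v ∘ₗ ρA g = ρB g ∘ₗ v := by
  apply LinearMap.ext
  intro x
  have h2 : ρB g (v (ρA g⁻¹ (ρA g x))) = v (ρA g x) := LinearMap.congr_fun h (ρA g x)
  rw [Representation.inv_self_apply] at h2
  exact h2.symm

lemma mkHom_surj (n : ℤ) (M : Rep.{0} ℤ G) : Function.Surjective (mkHom n M) := by
  intro t
  obtain ⟨⟨v, hv⟩, rfl⟩ := Submodule.Quotient.mk_surjective _ t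
  refine ⟨Rep.ofHom (ρ := (J G n).ρ) (σ := M.ρ) { toLinearMap := v, isIntertwining' := ?_ }, rfl⟩
  intro g
  have h := hv g
  exact linHom_inv_aux (J G n).ρ M.ρ v g h

lemma rnorm_conj {R A B : Type} [CommRing R] [AddCommGroup A] [AddCommGroup B] [Module R A]
    [Module R B] (ρA : Representation R G A) (ρB : Representation R G B) (h : A →ₗ[R] B) (v : A) :
    (rnorm (ρA.linHom ρB) h) v = ∑ g : G, ρB g (h (ρA g⁻¹ v)) := by
  rw [rnorm, LinearMap.sum_apply, LinearMap.sum_apply]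
  rfl

lemma mkHom_zero_iff (n : ℤ) (M : Rep.{0} ℤ G) (f : J G n ⟶ M) : mkHom n M f = 0 ↔ Null f := by
  refine (Submodule.Quotient.mk_eq_zero _).trans ⟨?_, ?_⟩
  · rintro ⟨h, hh⟩
    refine ⟨h, fun v => ?_⟩
    have h' := congrArg Subtype.val hh
    refine Eq.trans ?_ (rnorm_conj (J G n).ρ M.ρ h v)
    exact (LinearMap.congr_fun h' v).symm
  · rintro ⟨h, hh⟩
    refine ⟨h, ?_⟩
    apply Subtype.ext
    apply LinearMap.ext
    intro v
    exact (rnorm_conj _ _ h v).trans (hh v).symm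

lemma tmap_mkHom (n : ℤ) {M N : Rep.{0} ℤ G} (φ : M ⟶ N) (f : J G n ⟶ M) :
    tmap n φ (mkHom n M f) = mkHom n N (f ≫ φ) := rfl

lemma exists_E (n : ℤ) (M : Rep.{0} ℤ G) :
    ∃ e : tate n M ≃+ ((Q G).obj (J G n) ⟶ (Q G).obj M), ∀ f, e (mkHom n M f) = (Q G).map f :=
  exists_equiv_of_ker (mkHom n M) ((Q G).mapAddHom) (mkHom_surj n M) (Q G).map_surjective
    (fun f => (mkHom_zero_iff n M f).trans (Q_zero_iff f).symm)

section CurryAux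
variable {R X B A : Type} [CommRing R] [AddCommGroup A] [AddCommGroup B] [AddCommGroup X]
  [Module R A] [Module R B] [Module R X] (ρX : Representation R G X) (ρB : Representation R G B)
  (ρA : Representation R G A)

lemma curry_aux (k : B →ₗ[R] X →ₗ[R] A) (h : X ⊗[R] B →ₗ[R] A)
    (hk : ∀ x b, k b x = h (x ⊗ₜ b)) (x : X) (b : B) :
    (∑ g : G, (ρX.linHom ρA) g (k (ρB g⁻¹ b))) x
      = ∑ g : G, ρA g (h ((ρX.tprod ρB) g⁻¹ (x ⊗ₜ b))) := by
  rw [LinearMap.sum_apply]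
  refine Finset.sum_congr rfl fun g _ => ?_
  exact congrArg (ρA g) (hk _ _)

lemma curry_aux1 (f : X ⊗[R] B →ₗ[R] A) (k : B →ₗ[R] X →ₗ[R] A)
    (hk : ∀ b, (TensorProduct.curry f).flip b = ∑ g : G, (ρX.linHom ρA) g (k (ρB g⁻¹ b)))
    (v : X ⊗[R] B) :
    f v = ∑ g : G, ρA g (TensorProduct.lift k.flip ((ρX.tprod ρB) g⁻¹ v)) := by
  induction v using TensorProduct.induction_on with
  | zero => simp
  | add x y hx hy =>
    simp only [map_add, Finset.sum_add_distrib]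
    rw [← hx, ← hy]
  | tmul x b =>
    refine Eq.trans ?_ (curry_aux ρX ρB ρA k _ (fun x b => rfl) x b)
    exact LinearMap.congr_fun (hk b) x

lemma curry_aux2 (f : X ⊗[R] B →ₗ[R] A) (h : X ⊗[R] B →ₗ[R] A)
    (hh : ∀ v, f v = ∑ g : G, ρA g (h ((ρX.tprod ρB) g⁻¹ v))) (b : B) :
    (TensorProduct.curry f).flip b
      = ∑ g : G, (ρX.linHom ρA) g ((TensorProduct.curry h).flip (ρB g⁻¹ b)) := by
  apply LinearMap.ext
  intro x
  exact (hh (x ⊗ₜ b)).trans (curry_aux ρX ρB ρA _ h (fun x b => rfl) x b).symm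

end CurryAux

lemma null_curry {X B A : Rep.{0} ℤ G} (f : X ⊗ B ⟶ A) :
    Null (Rep.tensorHomEquiv X B A f) ↔ Null f := by
  constructor
  · rintro ⟨k, hk⟩
    exact ⟨_, curry_aux1 X.ρ B.ρ A.ρ f.hom.toLinearMap k hk⟩
  · rintro ⟨h, hh⟩
    exact ⟨_, curry_aux2 X.ρ B.ρ A.ρ f.hom.toLinearMap h hh⟩

/-- Currying as an additive equivalence. -/
noncomputable def curryAdd (X B A : Rep.{0} ℤ G) :
    ((X ⊗ B : Rep.{0} ℤ G) ⟶ A) ≃+ (B ⟶ hRep X A) where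
  toEquiv := Rep.tensorHomEquiv X B A
  map_add' _ _ := rfl

lemma curryAdd_comp {X B A A' : Rep.{0} ℤ G} (f : (X ⊗ B : Rep.{0} ℤ G) ⟶ A) (φ : A ⟶ A') :
    curryAdd X B A f ≫ (Rep.ihom X).map φ = curryAdd X B A' (f ≫ φ) := rfl

lemma exists_E2 (i : ℤ) (X A : Rep.{0} ℤ G) :
    ∃ e : tate i (hRep X A) ≃+ ((Q G).obj (X ⊗ J G i : Rep.{0} ℤ G) ⟶ (Q G).obj A),
      ∀ f, e (mkHom i _ (curryAdd X (J G i) A f)) = (Q G).map f :=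
  exists_equiv_of_ker ((mkHom i _).comp (curryAdd X (J G i) A).toAddMonoidHom) ((Q G).mapAddHom)
    ((mkHom_surj i _).comp (curryAdd X (J G i) A).surjective) (Q G).map_surjective
    (fun f => (mkHom_zero_iff i _ _).trans ((null_curry f).trans (Q_zero_iff f).symm))

/-- The comparison of Tate cohomology with stable morphisms. -/
noncomputable def E2 (i : ℤ) (X A : Rep.{0} ℤ G) :
    tate i (hRep X A) ≃+ ((Q G).obj (X ⊗ J G i : Rep.{0} ℤ G) ⟶ (Q G).obj A) :=
  (exists_E2 i X A).choose

lemma E2_mk (i : ℤ) (X A : Rep.{0} ℤ G) (f) :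
    E2 i X A (mkHom i _ (curryAdd X (J G i) A f)) = (Q G).map f := (exists_E2 i X A).choose_spec f

lemma E2_nat (i : ℤ) (X : Rep.{0} ℤ G) {A B : Rep.{0} ℤ G} (φ : A ⟶ B) (z : tate i (hRep X A)) :
    E2 i X B (tmap i ((Rep.ihom X).map φ) z) = E2 i X A z ≫ (Q G).map φ := by
  obtain ⟨f, rfl⟩ := mkHom_surj _ _ z
  obtain ⟨f, rfl⟩ := (curryAdd X (J G i) A).surjective f
  rw [tmap_mkHom, curryAdd_comp, E2_mk, E2_mk, Functor.map_comp]

lemma SI_J_zero (X : Rep.{0} ℤ G) : SI (X ⊗ J G 0) X := SI.of_iso (ρ_ X)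

lemma SI_of_enc (r : ℤ) (X : Rep.{0} ℤ G) (h : IsEncodingPair r X (𝟙_ (Rep.{0} ℤ G))) :
    SI X (J G r) := by
  obtain ⟨i, e, he⟩ := h
  let P : Rep.{0} ℤ G := X ⊗ J G i
  let P' : Rep.{0} ℤ G := 𝟙_ (Rep.{0} ℤ G) ⊗ J G (i + r)
  let F : ∀ A : Rep.{0} ℤ G, ((Q G).obj P ⟶ (Q G).obj A) ≃+ ((Q G).obj P' ⟶ (Q G).obj A) :=
    fun A => (E2 i X A).symm.trans ((e A).trans (E2 (i + r) (𝟙_ _) A))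
  have hF : ∀ {A B : Rep.{0} ℤ G} (φ : (Q G).obj A ⟶ (Q G).obj B) (u : (Q G).obj P ⟶ (Q G).obj A),
      F B (u ≫ φ) = F A u ≫ φ := by
    intro A B φ u
    obtain ⟨φ, rfl⟩ := (Q G).map_surjective φ
    obtain ⟨z, rfl⟩ := (E2 i X A).surjective u
    simp only [F, AddEquiv.trans_apply, ← E2_nat, AddEquiv.symm_apply_apply]
    rw [he, E2_nat]
  have hs : SI P P' := by
    refine ⟨⟨(F P').symm (𝟙 _), F P (𝟙 _), ?_, ?_⟩⟩
    · apply (F P).injective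
      rw [hF, AddEquiv.apply_symm_apply, Category.id_comp]
    · rw [← hF, Category.id_comp, AddEquiv.apply_symm_apply]
  have h1 : SI X (P ⊗ J G (-i)) := (SI_assoc_cancel (SI_J_neg i)).symm
  have h2 : SI P' (J G (i + r)) := SI.of_iso (λ_ _)
  have h3 : SI (J G (i + r) ⊗ J G (-i)) (J G r) :=
    (SI_J_add _ _).symm.trans (SI.of_eq (by congr 1; ring))
  exact h1.trans (((hs.trans h2).tensorRight _).trans h3)

lemma enc_of_SI (r : ℤ) (X : Rep.{0} ℤ G) (h : SI X (J G r)) :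
    IsEncodingPair r X (𝟙_ (Rep.{0} ℤ G)) := by
  have hs : SI (𝟙_ (Rep.{0} ℤ G) ⊗ J G (0 + r)) (X ⊗ J G 0) :=
    (SI.of_iso (λ_ _)).trans ((SI.of_eq (by rw [zero_add])).trans
      (h.symm.trans (SI_J_zero X).symm))
  obtain ⟨s⟩ := hs
  refine ⟨0, fun A => (E2 0 X A).trans (AddEquiv.trans
    { toFun := fun f => s.hom ≫ f
      invFun := fun f => s.inv ≫ f
      left_inv := fun f => by simp
      right_inv := fun f => by simp
      map_add' := fun f g => Preadditive.comp_add _ _ _ s.hom f g } (E2 (0 + r) (𝟙_ _) A).symm), ?_⟩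
  intro A B φ z
  simp only [AddEquiv.trans_apply]
  rw [AddEquiv.symm_apply_eq, E2_nat, E2_nat, AddEquiv.apply_symm_apply]
  exact (Category.assoc s.hom _ _).symm
end Fin

section Main
variable {G : Type} [Group G] [Fintype G]

/-- Transport of hom groups along isomorphisms. -/
noncomputable def homAdd {C : Type*} [Category C] [Preadditive C] {A A' B B' : C} (a : A ≅ A')
    (b : B ≅ B') : (A ⟶ B) ≃+ (A' ⟶ B') where
  toFun f := a.inv ≫ f ≫ b.hom
  invFun f := a.hom ≫ f ≫ b.inv
  left_inv f := by simp
  right_inv f := by simp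
  map_add' f g := by simp

instance (C : Rep.{0} ℤ G) : (TR C).Additive where
  map_add {A B f g} := by
    obtain ⟨f, rfl⟩ := (Q G).map_surjective (X := A.as) (Y := B.as) f
    obtain ⟨g, rfl⟩ := (Q G).map_surjective (X := A.as) (Y := B.as) g
    have h : (TR C).map ((Q G).map (f + g)) = (Q G).map (f ▷ C + g ▷ C) :=
      congrArg (Q G).map ((MonoidalCategory.tensorRight C).map_add)
    rw [(Q G).map_add, (Q G).map_add] at h
    exact h

/-- A fully faithful additive functor induces isomorphisms of hom groups. -/
noncomputable def ffAdd {C D : Type*} [Category C] [Preadditive C] [Category D] [Preadditive D]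
    (F : C ⥤ D) [F.Full] [F.Faithful] [F.Additive] (A B : C) :
    (A ⟶ B) ≃+ (F.obj A ⟶ F.obj B) :=
  AddEquiv.ofBijective F.mapAddHom ⟨F.map_injective, F.map_surjective⟩

lemma unit_smul_zero (z : ℤ) : z • 𝟙 ((Q G).obj (𝟙_ (Rep.{0} ℤ G))) = 0
    ↔ (Fintype.card G : ℤ) ∣ z := by
  constructor
  · intro h
    have h' : (Q G).map (z • 𝟙 (𝟙_ (Rep.{0} ℤ G))) = 0 := by
      rw [Functor.map_zsmul, CategoryTheory.Functor.map_id]; exact h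
    obtain ⟨k, hk⟩ := (Q_zero_iff _).1 h'
    let m : ℤ := k (1 : ℤ)
    have h1 : z * 1 = ∑ g : G, m := hk (1 : ℤ)
    rw [Finset.sum_const, Finset.card_univ, nsmul_eq_mul, mul_one] at h1
    exact ⟨_, h1⟩
  · rintro ⟨c, rfl⟩
    rw [mul_comm, mul_smul, st_card, smul_zero]

lemma unit_end_surj (f : 𝟙_ (Rep.{0} ℤ G) ⟶ 𝟙_ (Rep.{0} ℤ G)) : ∃ z : ℤ, f = z • 𝟙 _ := by
  let m : ℤ := f.hom (1 : ℤ)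
  refine ⟨m, ?_⟩
  apply Rep.Hom.ext
  apply Representation.IntertwiningMap.ext
  apply LinearMap.ext_ring (R := ℤ)
  exact (mul_one m).symm

lemma unit_end : Nonempty (((Q G).obj (𝟙_ (Rep.{0} ℤ G)) ⟶ (Q G).obj (𝟙_ (Rep.{0} ℤ G)))
    ≃+ ZMod (Fintype.card G)) := by
  obtain ⟨e, -⟩ := exists_equiv_of_ker
    (zmultiplesHom ((Q G).obj (𝟙_ (Rep.{0} ℤ G)) ⟶ (Q G).obj (𝟙_ (Rep.{0} ℤ G))) (𝟙 _))
    (Int.castAddHom (ZMod (Fintype.card G))) (by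
      intro f
      obtain ⟨f, rfl⟩ := (Q G).map_surjective f
      obtain ⟨z, rfl⟩ := unit_end_surj f
      refine ⟨z, ?_⟩
      rw [Functor.map_zsmul, CategoryTheory.Functor.map_id]
      rfl) (ZMod.intCast_surjective) (by
      intro z
      exact (unit_smul_zero z).trans (ZMod.intCast_zmod_eq_zero_iff_dvd z _).symm)
  exact ⟨e⟩

lemma J_end (r : ℤ) : Nonempty (((Q G).obj (J G r) ⟶ (Q G).obj (J G r))
    ≃+ ZMod (Fintype.card G)) := by
  obtain ⟨e⟩ := unit_end (G := G)
  let i : (TR (J G r)).obj ((Q G).obj (𝟙_ (Rep.{0} ℤ G))) ≅ (Q G).obj (J G r) :=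
    (Q G).mapIso (λ_ (J G r))
  exact ⟨((ffAdd (TR (J G r)) _ _).trans (homAdd i i)).symm.trans e⟩

lemma b_of_SI (r : ℤ) (X : Rep.{0} ℤ G) (h : SI X (J G r)) :
    Nonempty (tate r X ≃+ ZMod (Fintype.card G)) ∧
      Nonempty (tate 0 (hRep X X) ≃+ ZMod (Fintype.card G)) := by
  obtain ⟨e⟩ := J_end (G := G) r
  obtain ⟨s⟩ := h
  obtain ⟨t⟩ := SI_J_zero X
  obtain ⟨E, -⟩ := exists_E r X
  exact ⟨⟨(E.trans (homAdd (Iso.refl _) s)).trans e⟩,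
    ⟨((E2 0 X X).trans (homAdd (t ≪≫ s) s)).trans e⟩⟩

lemma dual_aux {W : Type} [AddCommGroup W] [hm : Module ℤ W] [Module.Free ℤ W]
    (ρ : Representation ℤ G W) (x : W) (hx : ∀ g, ρ g x = x)
    (hz : ∀ (z : ℤ) (w : W), z • x = ∑ g : G, ρ g w → (Fintype.card G : ℤ) ∣ z) :
    ∃ y : W →ₗ[ℤ] ℤ, (∀ g v, y (ρ g v) = y v) ∧ (Fintype.card G : ℤ) ∣ y x - 1 := by
  set n := Fintype.card G with hn
  have n0 : (n : ℚ) ≠ 0 := by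
    have : 0 < n := Fintype.card_pos
    positivity
  obtain rfl : hm = AddCommGroup.toIntModule W := Subsingleton.elim _ _
  let N : W →+ W := (rnorm ρ).toAddMonoidHom
  have hN : ∀ v, N v = ∑ g : G, ρ g v := fun v => LinearMap.sum_apply _ _ _
  have hNρ : ∀ g v, N (ρ g v) = N v := by
    intro g v
    rw [hN, hN, Fintype.sum_equiv (Equiv.mulRight g) _ (fun h => ρ h v)]
    intro h
    simp
  let M := W ⧸ N.range
  let mk : W →+ M := QuotientAddGroup.mk' N.range
  have hmk : ∀ v, mk v = 0 ↔ ∃ w, N w = v := fun v => QuotientAddGroup.eq_zero_iff v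
  have hmkN : ∀ v, mk (N v) = 0 := fun v => (hmk _).2 ⟨v, rfl⟩
  have hNx : N x = (n : ℤ) • x := by
    rw [hN]
    simp [hx, hn]
  let i : ZMod n →+ M := ZMod.lift n ⟨zmultiplesHom M (mk x), by
    show (n : ℤ) • mk x = 0
    rw [← map_zsmul, ← hNx]
    exact hmkN x⟩
  have hi1 : ∀ z : ℤ, i z = z • mk x := fun z => ZMod.lift_coe _ _ _
  have hi : Function.Injective i := by
    rw [injective_iff_map_eq_zero]
    intro a ha
    obtain ⟨z, rfl⟩ := ZMod.intCast_surjective a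
    rw [hi1, ← map_zsmul, hmk] at ha
    obtain ⟨w, hw⟩ := ha
    rw [ZMod.intCast_zmod_eq_zero_iff_dvd]
    exact hz z w (by rw [← hw, hN])
  let χ0 : ZMod n →+ AddCircle (1 : ℚ) := ZMod.lift n
    ⟨zmultiplesHom _ (((1 / n : ℚ)) : AddCircle (1 : ℚ)), by
      show (n : ℤ) • (((1 / n : ℚ)) : AddCircle (1 : ℚ)) = 0
      rw [← AddCircle.coe_zsmul, AddCircle.coe_eq_zero_iff]
      exact ⟨1, by simp [n0]⟩⟩
  have hχ1 : ∀ z : ℤ, χ0 z = z • (((1 / n : ℚ)) : AddCircle (1 : ℚ)) := fun z => ZMod.lift_coe _ _ _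
  obtain ⟨χ, hχ⟩ := (Module.Baer.of_divisible (AddCircle (1 : ℚ))).extension_property_addMonoidHom
    i hi χ0
  let b := Module.Free.chooseBasis ℤ W
  have hl : ∀ j, ∃ q : ℚ, (q : AddCircle (1 : ℚ)) = χ (mk (b j)) :=
    fun j => QuotientAddGroup.mk_surjective _
  choose l hl using hl
  let F : W →ₗ[ℤ] ℚ := b.constr ℤ l
  let c : ℚ →+ AddCircle (1 : ℚ) := QuotientAddGroup.mk' _
  have hF : ∀ v, c (F v) = χ (mk v) := by
    have : (c.comp F.toAddMonoidHom).toIntLinearMap = (χ.comp mk).toIntLinearMap := by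
      apply b.ext
      intro j
      show c (F (b j)) = χ (mk (b j))
      rw [← hl]
      exact congrArg c (b.constr_basis ℤ l j)
    exact fun v => LinearMap.congr_fun this v
  have hIsInt : ∀ v, ∃ z : ℤ, (z : ℚ) = F (N v) := by
    intro v
    have h1 : ((F (N v) : ℚ) : AddCircle (1 : ℚ)) = 0 := by
      refine (hF (N v)).trans ?_
      rw [hmkN, map_zero]
    obtain ⟨z, hz⟩ := (AddCircle.coe_eq_zero_iff _).1 h1
    exact ⟨z, by rw [← hz]; simp⟩
  choose y hy using hIsInt
  refine ⟨(AddMonoidHom.mk' y (fun a b => ?_)).toIntLinearMap, ?_, ?_⟩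
  · have : ((y (a + b) : ℤ) : ℚ) = ((y a + y b : ℤ) : ℚ) := by
      push_cast
      rw [hy, hy, hy, map_add, map_add]
    exact_mod_cast this
  · intro g v
    show y (ρ g v) = y v
    have : ((y (ρ g v) : ℤ) : ℚ) = ((y v : ℤ) : ℚ) := by
      rw [hy, hy, hNρ]
    exact_mod_cast this
  · show (n : ℤ) ∣ y x - 1
    have h1 : c (F x) = ((1 / n : ℚ) : AddCircle (1 : ℚ)) := by
      rw [hF]
      have h2 := DFunLike.congr_fun hχ ((1 : ℤ) : ZMod n)
      have h3 : χ (i ((1 : ℤ) : ZMod n)) = χ0 ((1 : ℤ) : ZMod n) := h2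
      rw [hi1, hχ1, one_smul, one_smul] at h3
      exact h3
    have h4 : ((F x - 1 / n : ℚ) : AddCircle (1 : ℚ)) = 0 := by
      rw [AddCircle.coe_sub, ← h1]
      exact sub_self _
    obtain ⟨z, hz⟩ := (AddCircle.coe_eq_zero_iff _).1 h4
    have h5 : (y x : ℚ) = n * F x := by
      rw [hy, hNx, map_zsmul]
      simp
    refine ⟨z, ?_⟩
    have h6 : ((y x - 1 : ℤ) : ℚ) = ((n * z : ℤ) : ℚ) := by
      push_cast
      rw [h5]
      have : (z : ℚ) = F x - 1 / n := by rw [← hz]; simp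
      rw [this]
      field_simp
    exact_mod_cast h6

lemma duality {W : Rep.{0} ℤ G} (hW : Module.Free ℤ W.V) (x : 𝟙_ (Rep.{0} ℤ G) ⟶ W)
    (hx : ∀ z : ℤ, z • (Q G).map x = 0 → (Fintype.card G : ℤ) ∣ z) :
    ∃ y : W ⟶ 𝟙_ (Rep.{0} ℤ G), (Q G).map x ≫ (Q G).map y = 𝟙 _ := by
  obtain ⟨y, hy1, hy2⟩ := dual_aux W.ρ (x.hom (1 : ℤ)) (fun g => by
      exact (Rep.hom_comm_apply x g (1 : ℤ)).symm) (fun z w h => by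
      refine hx z ?_
      rw [← Functor.map_zsmul, Q_zero_iff]
      refine ⟨LinearMap.toSpanSingleton ℤ _ w, ?_⟩
      intro (k : ℤ)
      have e1 : (z • x).hom k = k • (z • x.hom (1 : ℤ)) := by
        have : (z • x).hom k = z • x.hom k := rfl
        rw [this, smul_comm]
        congr 1
        have e2 : k = k • (1 : ℤ) := by simp
        conv_lhs => rw [e2]
        exact map_zsmul x.hom k (1 : ℤ)
      rw [e1, h]
      refine Eq.trans (map_sum (zsmulAddGroupHom (α := W.V) k) _ _) ?_
      refine Finset.sum_congr rfl fun g _ => ?_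
      exact ((map_zsmul (W.ρ g) k w).symm).trans
        (congrArg (W.ρ g) (int_smul_eq_zsmul W.hV2 k w).symm))
  let y' : W ⟶ 𝟙_ (Rep.{0} ℤ G) := Rep.ofHom (ρ := W.ρ) (σ := (𝟙_ (Rep.{0} ℤ G)).ρ)
    { toLinearMap := y
      isIntertwining' := fun g => by
        apply LinearMap.ext
        intro v
        exact hy1 g v }
  refine ⟨y', ?_⟩
  obtain ⟨z, hz⟩ := unit_end_surj (x ≫ y')
  have hz1 : y (x.hom (1 : ℤ)) = z := by
    have h1 : (x ≫ y').hom (1 : ℤ) = (z • 𝟙 (𝟙_ (Rep.{0} ℤ G))).hom (1 : ℤ) := by rw [hz]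
    have h2 : y (x.hom (1 : ℤ)) = z * 1 := h1
    rw [h2, mul_one]
  rw [hz1] at hy2
  rw [← Functor.map_comp, hz, Functor.map_zsmul, CategoryTheory.Functor.map_id]
  have := (unit_smul_zero (G := G) (z - 1)).2 hy2
  rw [sub_smul, one_smul] at this
  exact sub_eq_zero.1 this

lemma dualityT {X : Rep.{0} ℤ G} (hX : Module.Free ℤ X.V) (i : ℤ)
    (x : (Q G).obj (𝟙_ (Rep.{0} ℤ G)) ⟶ (TR (J G i)).obj ((Q G).obj X))
    (hx : ∀ z : ℤ, z • x = 0 → (Fintype.card G : ℤ) ∣ z) :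
    ∃ y : (TR (J G i)).obj ((Q G).obj X) ⟶ (Q G).obj (𝟙_ (Rep.{0} ℤ G)), x ≫ y = 𝟙 _ := by
  obtain ⟨x', rfl⟩ := (Q G).map_surjective (X := 𝟙_ (Rep.{0} ℤ G))
    (Y := (X ⊗ J G i : Rep.{0} ℤ G)) x
  obtain ⟨y, hy⟩ := duality (tensor_free hX (J_free i)) x' hx
  exact ⟨(Q G).map y, hy⟩

lemma SI_of_c (r : ℤ) (X : Rep.{0} ℤ G) (hX : Module.Free ℤ X.V)
    (h1 : Nonempty (tate r X ≃+ ZMod (Fintype.card G))) (h2 : IsAddCyclic (tate 0 (hRep X X))) :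
    SI X (J G r) := by
  -- endomorphisms are scalars
  have hend : ∀ f : (Q G).obj X ⟶ (Q G).obj X, ∃ z : ℤ, f = z • 𝟙 _ := by
    obtain ⟨t⟩ := SI_J_zero X
    let e := (E2 0 X X).trans (homAdd t (Iso.refl _))
    obtain ⟨u0, hu0⟩ := h2.exists_generator
    let u := e u0
    have hu : ∀ f : (Q G).obj X ⟶ (Q G).obj X, ∃ z : ℤ, f = z • u := by
      intro f
      obtain ⟨z, hz⟩ := hu0 (e.symm f)
      refine ⟨z, ?_⟩
      have hz' : z • u0 = e.symm f := hz
      rw [← map_zsmul, hz', AddEquiv.apply_symm_apply]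
    obtain ⟨a, ha⟩ := hu (𝟙 _)
    obtain ⟨b, hb⟩ := hu (u ≫ u)
    have hub : u = b • 𝟙 _ := by
      have : u = u ≫ 𝟙 _ := (Category.comp_id u).symm
      rw [this, ha, Preadditive.comp_zsmul, hb, smul_comm]
    intro f
    obtain ⟨z, hz⟩ := hu f
    exact ⟨z * b, by rw [mul_smul, ← hub, hz]⟩
  obtain ⟨e1⟩ := h1
  obtain ⟨E, -⟩ := exists_E r X
  let ε : ((Q G).obj (J G r) ⟶ (Q G).obj X) ≃+ ZMod (Fintype.card G) := E.symm.trans e1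
  let x := ε.symm 1
  have hx : ∀ z : ℤ, z • x = 0 → (Fintype.card G : ℤ) ∣ z := by
    intro z hz
    have h3 := congrArg ε hz
    rw [map_zsmul, AddEquiv.apply_symm_apply, map_zero, zsmul_one,
      ZMod.intCast_zmod_eq_zero_iff_dvd] at h3
    exact h3
  let T := TR (J G (-r))
  obtain ⟨s⟩ := (SI_J_neg (G := G) r).symm
  let s' : (Q G).obj (𝟙_ (Rep.{0} ℤ G)) ≅ T.obj ((Q G).obj (J G r)) := s
  have hx'z : ∀ z : ℤ, z • (s'.hom ≫ T.map x) = 0 → (Fintype.card G : ℤ) ∣ z := by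
    intro z hz
    apply hx
    apply T.map_injective
    rw [Functor.map_zsmul, Functor.map_zero]
    have h4 : s'.hom ≫ (z • T.map x) = 0 := by
      rw [Preadditive.comp_zsmul, hz]
    exact (Preadditive.IsIso.comp_left_eq_zero s'.hom _).1 h4
  obtain ⟨y', hy'⟩ := dualityT hX (-r) (s'.hom ≫ T.map x) hx'z
  let y0 : T.obj ((Q G).obj X) ⟶ T.obj ((Q G).obj (J G r)) := y' ≫ s'.hom
  obtain ⟨y, hy⟩ := T.map_surjective y0
  have hxy : x ≫ y = 𝟙 _ := by
    apply T.map_injective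
    rw [T.map_comp, hy, CategoryTheory.Functor.map_id]
    have h6 : s'.hom ≫ (T.map x ≫ y0) = s'.hom ≫ 𝟙 _ := by
      rw [Category.comp_id]
      calc s'.hom ≫ (T.map x ≫ y0) = ((s'.hom ≫ T.map x) ≫ y') ≫ s'.hom := by
            simp only [y0, Category.assoc]
        _ = s'.hom := by rw [hy', Category.id_comp]
    exact (cancel_epi s'.hom).1 h6
  obtain ⟨c, hc⟩ := hend (y ≫ x)
  have hcx : (c - 1) • x = 0 := by
    rw [sub_smul, one_smul, sub_eq_zero]
    calc c • x = x ≫ (c • 𝟙 _) := by rw [Preadditive.comp_zsmul, Category.comp_id]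
      _ = (x ≫ y) ≫ x := by rw [← hc, Category.assoc]
      _ = x := by rw [hxy, Category.id_comp]
  obtain ⟨d, hd⟩ := hx _ hcx
  have hyx : y ≫ x = 𝟙 _ := by
    have : (c - 1) • 𝟙 ((Q G).obj X) = 0 := by
      rw [hd, mul_comm, mul_smul, st_card, smul_zero]
    rw [sub_smul, one_smul, sub_eq_zero] at this
    rw [hc, this]
  exact ⟨⟨y, x, hyx, hxy⟩⟩

end Main

end EncP

theorem statement19 (G : Type) [Group G] [Fintype G] (X : Rep ℤ G)
    (hX : Module.Free ℤ X.V) (r : ℤ) :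
    (IsEncodingPair r X (Rep.trivial ℤ G ℤ) ↔
      (Nonempty (tate r X ≃+ ZMod (Fintype.card G)) ∧
        Nonempty (tate 0 (hRep X X) ≃+ ZMod (Fintype.card G)))) ∧
    (IsEncodingPair r X (Rep.trivial ℤ G ℤ) ↔
      (Nonempty (tate r X ≃+ ZMod (Fintype.card G)) ∧ IsAddCyclic (tate 0 (hRep X X)))) := by
  have hbc : (Nonempty (tate r X ≃+ ZMod (Fintype.card G)) ∧
        Nonempty (tate 0 (hRep X X) ≃+ ZMod (Fintype.card G))) →
      (Nonempty (tate r X ≃+ ZMod (Fintype.card G)) ∧ IsAddCyclic (tate 0 (hRep X X))) := by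
    rintro ⟨h1, ⟨e⟩⟩
    exact ⟨h1, isAddCyclic_of_surjective e.symm e.symm.surjective⟩
  have hab : IsEncodingPair r X (Rep.trivial ℤ G ℤ) →
      (Nonempty (tate r X ≃+ ZMod (Fintype.card G)) ∧
        Nonempty (tate 0 (hRep X X) ≃+ ZMod (Fintype.card G))) :=
    fun h => EncP.b_of_SI r X (EncP.SI_of_enc r X h)
  have hca : (Nonempty (tate r X ≃+ ZMod (Fintype.card G)) ∧ IsAddCyclic (tate 0 (hRep X X))) →
      IsEncodingPair r X (Rep.trivial ℤ G ℤ) :=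
    fun h => EncP.enc_of_SI r X (EncP.SI_of_c r X hX h.1 h.2)
  exact ⟨⟨hab, fun h => hca (hbc h)⟩, ⟨fun h => hbc (hab h), hca⟩⟩
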